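/- arXiv:2003.06582 — 12 statements merged into one kernel-verified Lean document; each statement's English description precedes it below -/
import Mathlib

section
/- With the almost abelian Hermitian setup below, the only possibly non-zero components of the Bismut connection are: ∇ᴮ_{e₁}e₁ = a e₂ₙ; ∇ᴮ_x e₁ = S(A)Jx + g(v,x) e₂ₙ for x ∈ 𝔫₁; ∇ᴮ_{e₁}e₂ₙ = −a e₁; ∇ᴮ_x y = g(x, S(A)Jy) e₁ + g(x, S(A)y) e₂ₙ for x, y ∈ 𝔫₁; ∇ᴮ_{e₁}y = −S(A)Jy for y ∈ 𝔫₁; ∇ᴮ_{e₂ₙ}y = ½(A − Aᵗ)y for y ∈ 𝔫₁; ∇ᴮ_x e₂ₙ = −g(v,x)e₁ − S(A)x for x ∈ 𝔫₁. In particular ∇ᴮ_{e₂ₙ}e₁ = 0 and ∇ᴮ_{e₂ₙ}e₂ₙ = 0. -/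
open RealInnerProductSpace Module

/-- Curvature of a (left-invariant) connection `B` on a Lie algebra with bracket `lb`:
`R(x,y)z = B_x B_y z - B_y B_x z - B_[x,y] z`. -/
def bismutCurv {G : Type*} [AddCommGroup G] [Module ℝ G]
    (lb B : G →ₗ[ℝ] G →ₗ[ℝ] G) (x y z : G) : G :=
  B x (B y z) - B y (B x z) - B (lb x y) z

/-- Torsion of a connection `B`: `T(x,y) = B_x y - B_y x - [x,y]`. -/
def bismutTorsion {G : Type*} [AddCommGroup G] [Module ℝ G]
    (lb B : G →ₗ[ℝ] G →ₗ[ℝ] G) (x y : G) : G :=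
  B x y - B y x - lb x y

theorem bismut_connection_almost_abelian
    {G : Type*} [NormedAddCommGroup G] [InnerProductSpace ℝ G] [FiniteDimensional ℝ G]
    (n : ℕ) (hn : 2 ≤ n) (hdim : finrank ℝ G = 2 * n)
    (e1 e2n : G) (N1 : Submodule ℝ G) (hdimN1 : finrank ℝ N1 = 2 * n - 2)
    (he1 : ⟪e1, e1⟫ = 1) (he2n : ⟪e2n, e2n⟫ = 1) (he12 : ⟪e1, e2n⟫ = 0)
    (he1N1 : ∀ x ∈ N1, ⟪e1, x⟫ = 0) (he2nN1 : ∀ x ∈ N1, ⟪e2n, x⟫ = 0)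
    (hspan : ∀ z : G, ∃ (s t : ℝ) (x : G), x ∈ N1 ∧ z = s • e1 + x + t • e2n)
    (J : G →ₗ[ℝ] G)
    (hJorth : ∀ x y : G, ⟪J x, J y⟫ = ⟪x, y⟫)
    (hJ2 : ∀ x : G, J (J x) = -x)
    (hJe1 : J e1 = e2n)
    (hJN1 : ∀ x ∈ N1, J x ∈ N1)
    (a : ℝ) (v : G) (hv : v ∈ N1)
    (A : G →ₗ[ℝ] G) (hAN1 : ∀ x ∈ N1, A x ∈ N1)
    (hAJ : ∀ x ∈ N1, A (J x) = J (A x))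
    (lb : G →ₗ[ℝ] G →ₗ[ℝ] G)
    (hanti : ∀ x y : G, lb x y = - lb y x)
    (hlb1 : lb e2n e1 = a • e1 + v)
    (hlb2 : ∀ x ∈ N1, lb e2n x = A x)
    (hlb0 : ∀ (s t : ℝ), ∀ x ∈ N1, ∀ y ∈ N1, lb (s • e1 + x) (t • e1 + y) = 0)
    (B : G →ₗ[ℝ] G →ₗ[ℝ] G)
    (hB : ∀ x y z : G, 2 * ⟪B x y, z⟫ =
      ⟪lb x y - lb (J x) (J y), z⟫ - ⟪lb x z - lb (J x) (J z), y⟫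
        - ⟪lb y z + lb (J y) (J z), x⟫)
    (At : G →ₗ[ℝ] G) (hAtN1 : ∀ x ∈ N1, At x ∈ N1)
    (hAt : ∀ x ∈ N1, ∀ y ∈ N1, ⟪A x, y⟫ = ⟪x, At y⟫)
    :
    B e1 e1 = a • e2n ∧
    (∀ x ∈ N1, B x e1 = ((1:ℝ)/2) • (A (J x) + At (J x)) + ⟪v, x⟫ • e2n) ∧
    B e1 e2n = -(a • e1) ∧
    (∀ x ∈ N1, ∀ y ∈ N1, B x y =
      ⟪x, ((1:ℝ)/2) • (A (J y) + At (J y))⟫ • e1 +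
        ⟪x, ((1:ℝ)/2) • (A y + At y)⟫ • e2n) ∧
    (∀ y ∈ N1, B e1 y = -(((1:ℝ)/2) • (A (J y) + At (J y)))) ∧
    (∀ y ∈ N1, B e2n y = ((1:ℝ)/2) • (A y - At y)) ∧
    (∀ x ∈ N1, B x e2n = -(⟪v, x⟫ • e1) - ((1:ℝ)/2) • (A x + At x)) ∧
    B e2n e1 = 0 ∧ B e2n e2n = 0 := by
  have hJe2 : J e2n = -e1 := by rw [← hJe1, hJ2]
  have ext3 : ∀ u w : G, ⟪u, e1⟫ = ⟪w, e1⟫ → ⟪u, e2n⟫ = ⟪w, e2n⟫ →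
      (∀ z ∈ N1, ⟪u, z⟫ = ⟪w, z⟫) → u = w := by
    intro u w h1 h2 h3
    refine ext_inner_right ℝ fun z => ?_
    obtain ⟨s, t, x, hx, rfl⟩ := hspan z
    simp only [inner_add_right, inner_smul_right, h1, h2, h3 x hx]
  have he21 : ⟪e2n, e1⟫ = 0 := by rw [real_inner_comm]; exact he12
  have hN1e1 : ∀ x ∈ N1, ⟪x, e1⟫ = 0 := fun x hx => by
    rw [real_inner_comm]; exact he1N1 x hx
  have hN1e2 : ∀ x ∈ N1, ⟪x, e2n⟫ = 0 := fun x hx => by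
    rw [real_inner_comm]; exact he2nN1 x hx
  have hself : ∀ x, lb x x = 0 := fun x => by
    have h2 : (2:ℝ) • lb x x = 0 := by
      rw [two_smul]; nth_rewrite 1 [hanti x x]; exact neg_add_cancel _
    exact (smul_eq_zero.mp h2).resolve_left two_ne_zero
  have l1x : ∀ x ∈ N1, lb e1 x = 0 := fun x hx => by
    simpa using hlb0 1 0 0 N1.zero_mem x hx
  have lx1 : ∀ x ∈ N1, lb x e1 = 0 := fun x hx => by rw [hanti, l1x x hx, neg_zero]
  have lxy : ∀ x ∈ N1, ∀ y ∈ N1, lb x y = 0 := fun x hx y hy => by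
    simpa using hlb0 0 0 x hx y hy
  have l12 : lb e1 e2n = -(a • e1 + v) := by rw [hanti, hlb1]
  have lx2 : ∀ x ∈ N1, lb x e2n = -A x := fun x hx => by rw [hanti, hlb2 x hx]
  have skew : ∀ x y : G, ⟪J x, y⟫ = -⟪x, J y⟫ := fun x y => by
    rw [← hJorth x (J y), hJ2, inner_neg_right, neg_neg]
  have AJs : ∀ x ∈ N1, ∀ y : G, ⟪A (J x), y⟫ = -⟪A x, J y⟫ := fun x hx y => by
    rw [hAJ x hx, skew]
  have At1 : ∀ x ∈ N1, ∀ y ∈ N1, ⟪x, At y⟫ = ⟪A x, y⟫ := fun x hx y hy => (hAt x hx y hy).symm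
  have At2 : ∀ x ∈ N1, ∀ y ∈ N1, ⟪At y, x⟫ = ⟪A x, y⟫ := fun x hx y hy => by
    rw [real_inner_comm]; exact At1 x hx y hy
  have Ac : ∀ x y : G, ⟪x, A y⟫ = ⟪A y, x⟫ := fun x y => real_inner_comm _ _
  have vc : ∀ x : G, ⟪x, v⟫ = ⟪v, x⟫ := fun x => real_inner_comm _ _
  have AtJ1 : ∀ x ∈ N1, ⟪At (J x), e1⟫ = 0 := fun x hx => hN1e1 _ (hAtN1 _ (hJN1 x hx))
  have AtJ2 : ∀ x ∈ N1, ⟪At (J x), e2n⟫ = 0 := fun x hx => hN1e2 _ (hAtN1 _ (hJN1 x hx))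
  refine ⟨?_, fun x hx => ?_, ?_, fun x hx y hy => ?_, fun y hy => ?_, fun y hy => ?_,
    fun x hx => ?_, ?_, ?_⟩
  all_goals
    refine ext3 _ _ ?_ ?_ fun z hz => ?_
  all_goals
    refine mul_left_cancel₀ (two_ne_zero' ℝ) ?_
    rw [hB]
    clear hB hanti hspan hlb0 hAt hAJ ext3 skew hdim hdimN1 hn
    simp [*, inner_add_left, inner_sub_left, inner_smul_left, inner_add_right, inner_sub_right,
      inner_smul_right, -inner_self_eq_norm_sq_to_K, -real_inner_self_eq_norm_sq]
  all_goals try ring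
end

section
/- With the almost abelian Hermitian setup below, if A ∈ 𝔰𝔬(𝔫₁), then the Bismut connection is given by: ∇ᴮ_{e₁}e₁ = a e₂ₙ, ∇ᴮ_x e₁ = g(v,x) e₂ₙ, ∇ᴮ_{e₁}e₂ₙ = −a e₁, ∇ᴮ_{e₂ₙ}y = A y, ∇ᴮ_x e₂ₙ = −g(v,x) e₁ for x, y ∈ 𝔫₁, and all other components vanish: ∇ᴮ_{e₁}y = 0 and ∇ᴮ_x y = 0 for x, y ∈ 𝔫₁, and ∇ᴮ_{e₂ₙ}e₁ = ∇ᴮ_{e₂ₙ}e₂ₙ = 0. -/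
open RealInnerProductSpace Module

theorem bismut_connection_almost_abelian_skew
    {G : Type*} [NormedAddCommGroup G] [InnerProductSpace ℝ G] [FiniteDimensional ℝ G]
    (n : ℕ) (hn : 2 ≤ n) (hdim : finrank ℝ G = 2 * n)
    (e1 e2n : G) (N1 : Submodule ℝ G) (hdimN1 : finrank ℝ N1 = 2 * n - 2)
    (he1 : ⟪e1, e1⟫ = 1) (he2n : ⟪e2n, e2n⟫ = 1) (he12 : ⟪e1, e2n⟫ = 0)
    (he1N1 : ∀ x ∈ N1, ⟪e1, x⟫ = 0) (he2nN1 : ∀ x ∈ N1, ⟪e2n, x⟫ = 0)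
    (hspan : ∀ z : G, ∃ (s t : ℝ) (x : G), x ∈ N1 ∧ z = s • e1 + x + t • e2n)
    (J : G →ₗ[ℝ] G)
    (hJorth : ∀ x y : G, ⟪J x, J y⟫ = ⟪x, y⟫)
    (hJ2 : ∀ x : G, J (J x) = -x)
    (hJe1 : J e1 = e2n)
    (hJN1 : ∀ x ∈ N1, J x ∈ N1)
    (a : ℝ) (v : G) (hv : v ∈ N1)
    (A : G →ₗ[ℝ] G) (hAN1 : ∀ x ∈ N1, A x ∈ N1)
    (hAJ : ∀ x ∈ N1, A (J x) = J (A x))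
    (lb : G →ₗ[ℝ] G →ₗ[ℝ] G)
    (hanti : ∀ x y : G, lb x y = - lb y x)
    (hlb1 : lb e2n e1 = a • e1 + v)
    (hlb2 : ∀ x ∈ N1, lb e2n x = A x)
    (hlb0 : ∀ (s t : ℝ), ∀ x ∈ N1, ∀ y ∈ N1, lb (s • e1 + x) (t • e1 + y) = 0)
    (B : G →ₗ[ℝ] G →ₗ[ℝ] G)
    (hB : ∀ x y z : G, 2 * ⟪B x y, z⟫ =
      ⟪lb x y - lb (J x) (J y), z⟫ - ⟪lb x z - lb (J x) (J z), y⟫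
        - ⟪lb y z + lb (J y) (J z), x⟫)
    (hskew : ∀ x ∈ N1, ∀ y ∈ N1, ⟪A x, y⟫ = -⟪x, A y⟫)
    :
    B e1 e1 = a • e2n ∧
    (∀ x ∈ N1, B x e1 = ⟪v, x⟫ • e2n) ∧
    B e1 e2n = -(a • e1) ∧
    (∀ y ∈ N1, B e2n y = A y) ∧
    (∀ x ∈ N1, B x e2n = -(⟪v, x⟫ • e1)) ∧
    (∀ y ∈ N1, B e1 y = 0) ∧
    (∀ x ∈ N1, ∀ y ∈ N1, B x y = 0) ∧
    B e2n e1 = 0 ∧ B e2n e2n = 0 := by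
  have ext : ∀ p q : G, 2 * ⟪p, e1⟫ = 2 * ⟪q, e1⟫ → 2 * ⟪p, e2n⟫ = 2 * ⟪q, e2n⟫ →
      (∀ z ∈ N1, 2 * ⟪p, z⟫ = 2 * ⟪q, z⟫) → p = q := by
    intro p q h1 h2 h3
    refine ext_inner_right ℝ fun z => ?_
    obtain ⟨s, t, x, hx, rfl⟩ := hspan z
    have h3 := h3 x hx
    simp only [inner_add_right, inner_smul_right]
    have h1' : ⟪p, e1⟫ = ⟪q, e1⟫ := by linarith
    have h2' : ⟪p, e2n⟫ = ⟪q, e2n⟫ := by linarith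
    have h3' : ⟪p, x⟫ = ⟪q, x⟫ := by linarith
    rw [h1', h2', h3']
  have hJe2 : J e2n = -e1 := by rw [← hJe1, hJ2]
  have he21 : ⟪e2n, e1⟫ = 0 := by rw [real_inner_comm]; exact he12
  have hN1e1 : ∀ x ∈ N1, ⟪x, e1⟫ = 0 := fun x hx => by
    rw [real_inner_comm]; exact he1N1 x hx
  have hN1e2 : ∀ x ∈ N1, ⟪x, e2n⟫ = 0 := fun x hx => by
    rw [real_inner_comm]; exact he2nN1 x hx
  have l11 : lb e1 e1 = 0 := by simpa using hlb0 1 1 0 N1.zero_mem 0 N1.zero_mem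
  have l1x : ∀ x ∈ N1, lb e1 x = 0 := fun x hx => by
    simpa using hlb0 1 0 0 N1.zero_mem x hx
  have lx1 : ∀ x ∈ N1, lb x e1 = 0 := fun x hx => by
    simpa using hlb0 0 1 x hx 0 N1.zero_mem
  have lxy : ∀ x ∈ N1, ∀ y ∈ N1, lb x y = 0 := fun x hx y hy => by
    simpa using hlb0 0 0 x hx y hy
  have l12 : lb e1 e2n = -(a • e1 + v) := by rw [hanti, hlb1]
  have lx2 : ∀ x ∈ N1, lb x e2n = -A x := fun x hx => by rw [hanti, hlb2 x hx]
  have l22 : lb e2n e2n = 0 := by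
    have h := hanti e2n e2n
    have h2 : (2:ℝ) • lb e2n e2n = 0 := by
      rw [two_smul]; nth_rewrite 1 [h]; simp
    simpa using h2
  have hJs : ∀ x y : G, ⟪J x, y⟫ = -⟪x, J y⟫ := fun x y => by
    rw [← hJorth x (J y), hJ2, inner_neg_right, neg_neg]
  have hsym : ∀ x ∈ N1, ∀ y ∈ N1, ⟪J (A x), y⟫ = ⟪J (A y), x⟫ := fun x hx y hy => by
    rw [hJs, hskew x hx _ (hJN1 y hy), hAJ y hy, real_inner_comm]; ring
  have hsk : ∀ x ∈ N1, ∀ y ∈ N1, ⟪A x, y⟫ = -⟪A y, x⟫ := fun x hx y hy => by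
    rw [hskew x hx y hy, real_inner_comm]
  refine ⟨?_, fun x hx => ?_, ?_, fun x hx => ?_, fun x hx => ?_, fun x hx => ?_,
    fun x hx y hy => ?_, ?_, ?_⟩ <;> refine ext _ _ ?_ ?_ (fun z hz => ?_) <;> rw [hB] <;>
    (try have hAx := hAN1 x hx) <;> (try have hAy := hAN1 y hy) <;>
    (try have hAz := hAN1 z hz) <;>
    (try have hJx := hJN1 x hx) <;> (try have hJy := hJN1 y hy) <;>
    (try have hJz := hJN1 z hz) <;>
    (try have hJAx := hJN1 _ hAx) <;> (try have hJAy := hJN1 _ hAy) <;>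
    (try have hJAz := hJN1 _ hAz) <;>
    (try have s1 := hsk x hx z hz) <;> (try have s2 := hsk x hx y hy) <;>
    (try have s3 := hsk y hy z hz) <;> (try have t1 := hsym x hx z hz) <;>
    (try have t2 := hsym x hx y hy) <;> (try have t3 := hsym y hy z hz) <;>
    simp (disch := assumption) only [hJe1, hJe2, map_neg, LinearMap.neg_apply, l11, l12, l22, hlb1, inner_add_left,
      inner_sub_left, inner_neg_left, real_inner_smul_left, inner_zero_left, he1, he2n, he12,
      he21, neg_neg, inner_neg_right, hlb2, lx2, l1x, lx1, lxy, hAJ, he1N1, he2nN1, hN1e1, hN1e2,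
      mul_zero, sub_zero] <;> ring_nf <;> try linarith
end

section
/- With the almost abelian Hermitian setup below, assume A ∈ 𝔰𝔬(𝔫₁). Then the only possibly non-zero components of the Bismut curvature tensor are, for y ∈ 𝔫₁: Rᴮ(e₂ₙ, y)e₁ = −g(v, Ay) e₂ₙ, Rᴮ(e₂ₙ, y)e₂ₙ = g(v, Ay) e₁, Rᴮ(e₁, e₂ₙ)e₁ = (a² + |v|²) e₂ₙ, and Rᴮ(e₁, e₂ₙ)e₂ₙ = −(a² + |v|²) e₁. In particular Rᴮ(x, y)z = 0 for all x, y ∈ 𝔫₁ and z ∈ 𝔤, Rᴮ(e₁, y)z = 0 for all y ∈ 𝔫₁ and z ∈ 𝔤, and Rᴮ(e₂ₙ, y)x = 0 and Rᴮ(e₁, e₂ₙ)x = 0 for all x, y ∈ 𝔫₁. -/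
open RealInnerProductSpace Module

set_option linter.unusedSimpArgs false in
set_option maxHeartbeats 1000000 in
theorem bismut_curvature_almost_abelian_skew
    {G : Type*} [NormedAddCommGroup G] [InnerProductSpace ℝ G] [FiniteDimensional ℝ G]
    (n : ℕ) (hn : 2 ≤ n) (hdim : finrank ℝ G = 2 * n)
    (e1 e2n : G) (N1 : Submodule ℝ G) (hdimN1 : finrank ℝ N1 = 2 * n - 2)
    (he1 : ⟪e1, e1⟫ = 1) (he2n : ⟪e2n, e2n⟫ = 1) (he12 : ⟪e1, e2n⟫ = 0)
    (he1N1 : ∀ x ∈ N1, ⟪e1, x⟫ = 0) (he2nN1 : ∀ x ∈ N1, ⟪e2n, x⟫ = 0)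
    (hspan : ∀ z : G, ∃ (s t : ℝ) (x : G), x ∈ N1 ∧ z = s • e1 + x + t • e2n)
    (J : G →ₗ[ℝ] G)
    (hJorth : ∀ x y : G, ⟪J x, J y⟫ = ⟪x, y⟫)
    (hJ2 : ∀ x : G, J (J x) = -x)
    (hJe1 : J e1 = e2n)
    (hJN1 : ∀ x ∈ N1, J x ∈ N1)
    (a : ℝ) (v : G) (hv : v ∈ N1)
    (A : G →ₗ[ℝ] G) (hAN1 : ∀ x ∈ N1, A x ∈ N1)
    (hAJ : ∀ x ∈ N1, A (J x) = J (A x))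
    (lb : G →ₗ[ℝ] G →ₗ[ℝ] G)
    (hanti : ∀ x y : G, lb x y = - lb y x)
    (hlb1 : lb e2n e1 = a • e1 + v)
    (hlb2 : ∀ x ∈ N1, lb e2n x = A x)
    (hlb0 : ∀ (s t : ℝ), ∀ x ∈ N1, ∀ y ∈ N1, lb (s • e1 + x) (t • e1 + y) = 0)
    (B : G →ₗ[ℝ] G →ₗ[ℝ] G)
    (hB : ∀ x y z : G, 2 * ⟪B x y, z⟫ =
      ⟪lb x y - lb (J x) (J y), z⟫ - ⟪lb x z - lb (J x) (J z), y⟫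
        - ⟪lb y z + lb (J y) (J z), x⟫)
    (hskew : ∀ x ∈ N1, ∀ y ∈ N1, ⟪A x, y⟫ = -⟪x, A y⟫)
    :
    (∀ y ∈ N1, bismutCurv lb B e2n y e1 = -(⟪v, A y⟫ • e2n)) ∧
    (∀ y ∈ N1, bismutCurv lb B e2n y e2n = ⟪v, A y⟫ • e1) ∧
    bismutCurv lb B e1 e2n e1 = (a ^ 2 + ‖v‖ ^ 2) • e2n ∧
    bismutCurv lb B e1 e2n e2n = -((a ^ 2 + ‖v‖ ^ 2) • e1) ∧
    (∀ x ∈ N1, ∀ y ∈ N1, ∀ z : G, bismutCurv lb B x y z = 0) ∧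
    (∀ y ∈ N1, ∀ z : G, bismutCurv lb B e1 y z = 0) ∧
    (∀ x ∈ N1, ∀ y ∈ N1, bismutCurv lb B e2n y x = 0) ∧
    (∀ x ∈ N1, bismutCurv lb B e1 e2n x = 0) := by
  have n1 : ‖e1‖ = 1 := by
    rw [norm_eq_sqrt_real_inner, he1, Real.sqrt_one]
  have n2 : ‖e2n‖ = 1 := by
    rw [norm_eq_sqrt_real_inner, he2n, Real.sqrt_one]
  have hJe2 : J e2n = -e1 := by rw [← hJe1, hJ2]
  have he21 : ⟪e2n, e1⟫ = 0 := by rw [real_inner_comm]; exact he12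
  have hN1e1 : ∀ x ∈ N1, ⟪x, e1⟫ = 0 := fun x hx => by rw [real_inner_comm]; exact he1N1 x hx
  have hN1e2 : ∀ x ∈ N1, ⟪x, e2n⟫ = 0 := fun x hx => by rw [real_inner_comm]; exact he2nN1 x hx
  have h11 : lb e1 e1 = 0 := by simpa using hlb0 1 1 0 N1.zero_mem 0 N1.zero_mem
  have h1x : ∀ x ∈ N1, lb e1 x = 0 := fun x hx => by
    simpa using hlb0 1 0 0 N1.zero_mem x hx
  have hx1 : ∀ x ∈ N1, lb x e1 = 0 := fun x hx => by
    simpa using hlb0 0 1 x hx 0 N1.zero_mem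
  have hxy : ∀ x ∈ N1, ∀ y ∈ N1, lb x y = 0 := fun x hx y hy => by
    simpa using hlb0 0 0 x hx y hy
  have h12 : lb e1 e2n = -(a • e1 + v) := by rw [hanti, hlb1]
  have hx2 : ∀ x ∈ N1, lb x e2n = -(A x) := fun x hx => by rw [hanti, hlb2 x hx]
  have h22 : lb e2n e2n = 0 := by
    have h := hanti e2n e2n
    have h2 : (2 : ℝ) • lb e2n e2n = 0 := by
      rw [two_smul]; exact add_eq_zero_iff_eq_neg.mpr h
    exact (smul_eq_zero.mp h2).resolve_left two_ne_zero
  have hJs : ∀ x y, ⟪J x, y⟫ = -⟪x, J y⟫ := fun x y => by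
    rw [← hJorth x (J y), hJ2, inner_neg_right, neg_neg]
  have hAJs : ∀ x ∈ N1, ∀ y ∈ N1, ⟪A (J x), y⟫ = ⟪A (J y), x⟫ := fun x hx y hy => by
    rw [hskew _ (hJN1 x hx) y hy, hJs, neg_neg, ← hAJ y hy, real_inner_comm]
  have hAs : ∀ x ∈ N1, ∀ y ∈ N1, ⟪A y, x⟫ = -⟪A x, y⟫ := fun x hx y hy => by
    rw [hskew _ hy x hx, real_inner_comm]
  have key : ∀ p q : G, 2 * ⟪p, e1⟫ = 2 * ⟪q, e1⟫ → 2 * ⟪p, e2n⟫ = 2 * ⟪q, e2n⟫ →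
      (∀ y ∈ N1, 2 * ⟪p, y⟫ = 2 * ⟪q, y⟫) → p = q := by
    intro p q h1 h2 h3
    apply ext_inner_right ℝ
    intro z
    obtain ⟨s, t, x, hx, rfl⟩ := hspan z
    have h3 := h3 x hx
    simp only [inner_add_right, inner_smul_right]
    have e1' : ⟪p, e1⟫ = ⟪q, e1⟫ := by linarith
    have e2' : ⟪p, e2n⟫ = ⟪q, e2n⟫ := by linarith
    have e3' : ⟪p, x⟫ = ⟪q, x⟫ := by linarith
    rw [e1', e2', e3']
  have hv1 := hN1e1 v hv
  have hv2 := hN1e2 v hv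
  have b11 : B e1 e1 = a • e2n := by
    apply key
    · rw [hB]; simp [h11, h22, h12, hlb1, hJe1, hJe2, n1, n2, he12, he21, hv1, hv2,
        inner_add_left, inner_sub_left, inner_smul_left]
    · rw [hB]; simp [h11, h22, h12, hlb1, hJe1, hJe2, n1, n2, he12, he21, hv1, hv2,
        inner_add_left, inner_sub_left, inner_smul_left]; try ring
    · intro y hy
      have m1 := hJN1 y hy
      have m2 := hAN1 _ m1
      have m3 := hAN1 _ hy
      rw [hB]; simp [h11, h22, h12, hlb1, hJe1, hJe2, n1, n2, he12, he21, hv1, hv2, h1x y hy, hx1 y hy, hlb2 y hy, hx2 y hy, h1x _ m1, hx1 _ m1, hlb2 _ m1, hx2 _ m1,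
        hN1e1 _ m2, hN1e2 _ m2, hN1e1 _ m3, hN1e2 _ m3, he1N1 y hy, he2nN1 y hy,
        inner_add_left, inner_sub_left, inner_smul_left]
  have b12 : B e1 e2n = -(a • e1) := by
    apply key
    · rw [hB]; simp [h11, h22, h12, hlb1, hJe1, hJe2, n1, n2, he12, he21, hv1, hv2,
        inner_add_left, inner_sub_left, inner_smul_left]; try ring
    · rw [hB]; simp [h11, h22, h12, hlb1, hJe1, hJe2, n1, n2, he12, he21, hv1, hv2,
        inner_add_left, inner_sub_left, inner_smul_left]
    · intro y hy
      have m1 := hJN1 y hy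
      have m2 := hAN1 _ m1
      have m3 := hAN1 _ hy
      rw [hB]; simp [h11, h22, h12, hlb1, hJe1, hJe2, n1, n2, he12, he21, hv1, hv2, h1x y hy, hx1 y hy, hlb2 y hy, hx2 y hy, h1x _ m1, hx1 _ m1, hlb2 _ m1, hx2 _ m1,
        hN1e1 _ m2, hN1e2 _ m2, hN1e1 _ m3, hN1e2 _ m3, he1N1 y hy, he2nN1 y hy,
        inner_add_left, inner_sub_left, inner_smul_left]
  have b21 : B e2n e1 = 0 := by
    apply key
    · rw [hB]; simp [h11, h22, h12, hlb1, hJe1, hJe2, n1, n2, he12, he21, hv1, hv2,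
        inner_add_left, inner_sub_left, inner_smul_left]
    · rw [hB]; simp [h11, h22, h12, hlb1, hJe1, hJe2, n1, n2, he12, he21, hv1, hv2,
        inner_add_left, inner_sub_left, inner_smul_left]
    · intro y hy
      have m1 := hJN1 y hy
      have m2 := hAN1 _ m1
      have m3 := hAN1 _ hy
      rw [hB]; simp [h11, h22, h12, hlb1, hJe1, hJe2, n1, n2, he12, he21, hv1, hv2, h1x y hy, hx1 y hy, hlb2 y hy, hx2 y hy, h1x _ m1, hx1 _ m1, hlb2 _ m1, hx2 _ m1,
        hN1e1 _ m2, hN1e2 _ m2, hN1e1 _ m3, hN1e2 _ m3, he1N1 y hy, he2nN1 y hy,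
        inner_add_left, inner_sub_left, inner_smul_left]
  have b22 : B e2n e2n = 0 := by
    apply key
    · rw [hB]; simp [h11, h22, h12, hlb1, hJe1, hJe2, n1, n2, he12, he21, hv1, hv2,
        inner_add_left, inner_sub_left, inner_smul_left]
    · rw [hB]; simp [h11, h22, h12, hlb1, hJe1, hJe2, n1, n2, he12, he21, hv1, hv2,
        inner_add_left, inner_sub_left, inner_smul_left]
    · intro y hy
      have m1 := hJN1 y hy
      have m2 := hAN1 _ m1
      have m3 := hAN1 _ hy
      rw [hB]; simp [h11, h22, h12, hlb1, hJe1, hJe2, n1, n2, he12, he21, hv1, hv2, h1x y hy, hx1 y hy, hlb2 y hy, hx2 y hy, h1x _ m1, hx1 _ m1, hlb2 _ m1, hx2 _ m1,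
        hN1e1 _ m2, hN1e2 _ m2, hN1e1 _ m3, hN1e2 _ m3, he1N1 y hy, he2nN1 y hy,
        inner_add_left, inner_sub_left, inner_smul_left]
  have b1x : ∀ x ∈ N1, B e1 x = 0 := by
    intro x hx
    have m1 := hJN1 x hx
    have m2 := hAN1 _ m1
    have m3 := hAN1 _ hx
    apply key
    · rw [hB, hJe1, h11, h22, h1x x hx, hlb2 _ m1, hx1 x hx, hx2 _ m1]
      simp [hN1e1 _ m2]
    · rw [hB, hJe1, hJe2, h12, h1x x hx, hlb2 _ m1, map_neg, hlb1, hx2 x hx, map_neg, hx1 _ m1]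
      simp [hN1e2 _ m2, hN1e1 _ m3]
    · intro y hy
      have m1' := hJN1 y hy
      rw [hB, hJe1, h1x x hx, h1x y hy, hlb2 _ m1, hlb2 _ m1', hxy x hx y hy, hxy _ m1 _ m1']
      simp [hAJs x hx y hy]
  have b2x : ∀ x ∈ N1, B e2n x = A x := by
    intro x hx
    have m1 := hJN1 x hx
    have m2 := hAN1 _ m1
    have m3 := hAN1 _ hx
    have m4 := hAN1 _ m2
    apply key
    · rw [hB, hJe1, hJe2, hlb1, hlb2 x hx, map_neg]
      simp [h1x _ m1, h12, hx1 x hx, hx2 _ m1, hN1e1 _ m3, hN1e2 _ m2, inner_add_left,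
        inner_smul_left, he1N1 x hx]
    · rw [hB, hJe2, h22, hlb2 x hx, hx2 x hx]
      simp [h1x _ m1, h11, hx1 _ m1, hN1e2 _ m3]
    · intro y hy
      have m1' := hJN1 y hy
      rw [hB, hJe2, hlb2 x hx, hlb2 y hy, hxy x hx y hy, hxy _ m1 _ m1']
      simp [h1x _ m1, h1x _ m1', hAs x hx y hy]; ring
  have bx1 : ∀ x ∈ N1, B x e1 = ⟪v, x⟫ • e2n := by
    intro x hx
    have m1 := hJN1 x hx
    have m2 := hAN1 _ m1
    have m3 := hAN1 _ hx
    apply key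
    · rw [hB, hJe1, h11, h22, hx1 x hx, hx2 _ m1]
      simp [hN1e1 _ m2, inner_smul_left, he21]
    · rw [hB, hJe1, hJe2, h12, hx1 x hx, hx2 _ m1, hx2 x hx, map_neg, map_neg, hx1 _ m1, hlb1]
      simp [hN1e2 _ m2, hN1e1 _ m3, inner_smul_left, n2, inner_add_left, he1N1 x hx]; ring
    · intro y hy
      have m1' := hJN1 y hy
      rw [hB, hJe1, hx1 x hx, hx2 _ m1, hxy x hx y hy, hxy _ m1 _ m1', h1x y hy, hlb2 _ m1']
      simp [inner_smul_left, he2nN1 y hy, hAJs x hx y hy]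
  have bx2 : ∀ x ∈ N1, B x e2n = -(⟪v, x⟫ • e1) := by
    intro x hx
    have m1 := hJN1 x hx
    have m2 := hAN1 _ m1
    have m3 := hAN1 _ hx
    apply key
    · rw [hB, hJe1, hJe2, hlb1, hx1 x hx, hx2 _ m1, hx2 x hx, map_neg, map_neg, hx1 _ m1]
      simp [hN1e2 _ m2, hN1e1 _ m3, inner_smul_left, n1, inner_add_left, he1N1 x hx, h12]; ring
    · rw [hB, hJe2, h22, hx2 x hx, map_neg, hx1 _ m1]
      simp [hN1e2 _ m3, inner_smul_left, he12, h11]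
    · intro y hy
      have m1' := hJN1 y hy
      rw [hB, hJe2, hx2 x hx, hxy x hx y hy, hxy _ m1 _ m1', hlb2 y hy, map_neg, hx1 _ m1]
      simp [inner_smul_left, he1N1 y hy, h1x _ m1', hAs x hx y hy]
  have bxy : ∀ x ∈ N1, ∀ y ∈ N1, B x y = 0 := by
    intro x hx y hy
    have m1 := hJN1 x hx
    have m2 := hAN1 _ m1
    have m3 := hAN1 _ hx
    have m1' := hJN1 y hy
    have m2' := hAN1 _ m1'
    have m3' := hAN1 _ hy
    apply key
    · rw [hB, hJe1, hxy x hx y hy, hxy _ m1 _ m1', hx1 x hx, hx2 _ m1, hx1 y hy, hx2 _ m1']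
      simp [hAJs x hx y hy]
    · rw [hB, hJe2, hxy x hx y hy, hxy _ m1 _ m1', hx2 x hx, hx2 y hy, map_neg, map_neg,
        hx1 _ m1, hx1 _ m1']
      simp [hAs x hx y hy]
    · intro z hz
      have m1'' := hJN1 z hz
      rw [hB, hxy x hx y hy, hxy _ m1 _ m1', hxy x hx z hz, hxy _ m1 _ m1'', hxy y hy z hz,
        hxy _ m1' _ m1'']
      simp
  unfold bismutCurv
  refine ⟨?_, ?_, ?_, ?_, ?_, ?_, ?_, ?_⟩
  · intro y hy
    simp [bx1 y hy, b21, b22, hlb2 y hy, bx1 _ (hAN1 y hy)]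
  · intro y hy
    simp [bx2 y hy, b21, b22, hlb2 y hy, bx2 _ (hAN1 y hy)]
  · simp [b21, b11, b22, h12, bx1 v hv]
    module
  · simp [b21, b12, b22, h12, bx2 v hv]
    module
  · intro x hx y hy z
    obtain ⟨s, t, w, hw, rfl⟩ := hspan z
    simp [bx1 x hx, bx1 y hy, bx2 x hx, bx2 y hy, bxy x hx w hw, bxy y hy w hw, hxy x hx y hy]
    module
  · intro y hy z
    obtain ⟨s, t, w, hw, rfl⟩ := hspan z
    simp [b11, b12, b1x w hw, bx1 y hy, bx2 y hy, bxy y hy w hw, h1x y hy]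
    module
  · intro x hx y hy
    simp [bxy y hy x hx, b2x x hx, bxy y hy _ (hAN1 x hx), hlb2 y hy, bxy _ (hAN1 y hy) x hx]
  · intro x hx
    simp [b2x x hx, b1x x hx, b1x _ (hAN1 x hx), h12, bxy v hv x hx]
end

section
/- With the almost abelian Hermitian setup below, assume A ∈ 𝔰𝔬(𝔫₁). Then the Bismut connection is Kähler-like (i.e., Rᴮ satisfies the first Bianchi identity and the type condition Rᴮ(x,y,z,w) = Rᴮ(Jx,Jy,z,w) for all x,y,z,w ∈ 𝔤) if and only if g(Av, y) = 0 for every y ∈ 𝔫₁ (i.e., Av is g-orthogonal to 𝔫₁). -/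
open RealInnerProductSpace Module

theorem bismut_kaehler_like_iff_almost_abelian
    {G : Type*} [NormedAddCommGroup G] [InnerProductSpace ℝ G] [FiniteDimensional ℝ G]
    (n : ℕ) (hn : 2 ≤ n) (hdim : finrank ℝ G = 2 * n)
    (e1 e2n : G) (N1 : Submodule ℝ G) (hdimN1 : finrank ℝ N1 = 2 * n - 2)
    (he1 : ⟪e1, e1⟫ = 1) (he2n : ⟪e2n, e2n⟫ = 1) (he12 : ⟪e1, e2n⟫ = 0)
    (he1N1 : ∀ x ∈ N1, ⟪e1, x⟫ = 0) (he2nN1 : ∀ x ∈ N1, ⟪e2n, x⟫ = 0)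
    (hspan : ∀ z : G, ∃ (s t : ℝ) (x : G), x ∈ N1 ∧ z = s • e1 + x + t • e2n)
    (J : G →ₗ[ℝ] G)
    (hJorth : ∀ x y : G, ⟪J x, J y⟫ = ⟪x, y⟫)
    (hJ2 : ∀ x : G, J (J x) = -x)
    (hJe1 : J e1 = e2n)
    (hJN1 : ∀ x ∈ N1, J x ∈ N1)
    (a : ℝ) (v : G) (hv : v ∈ N1)
    (A : G →ₗ[ℝ] G) (hAN1 : ∀ x ∈ N1, A x ∈ N1)
    (hAJ : ∀ x ∈ N1, A (J x) = J (A x))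
    (lb : G →ₗ[ℝ] G →ₗ[ℝ] G)
    (hanti : ∀ x y : G, lb x y = - lb y x)
    (hlb1 : lb e2n e1 = a • e1 + v)
    (hlb2 : ∀ x ∈ N1, lb e2n x = A x)
    (hlb0 : ∀ (s t : ℝ), ∀ x ∈ N1, ∀ y ∈ N1, lb (s • e1 + x) (t • e1 + y) = 0)
    (B : G →ₗ[ℝ] G →ₗ[ℝ] G)
    (hB : ∀ x y z : G, 2 * ⟪B x y, z⟫ =
      ⟪lb x y - lb (J x) (J y), z⟫ - ⟪lb x z - lb (J x) (J z), y⟫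
        - ⟪lb y z + lb (J y) (J z), x⟫)
    (hskew : ∀ x ∈ N1, ∀ y ∈ N1, ⟪A x, y⟫ = -⟪x, A y⟫)
    :
    ((∀ x y z : G,
        bismutCurv lb B x y z + bismutCurv lb B y z x + bismutCurv lb B z x y = 0) ∧
      (∀ x y z w : G,
        ⟪bismutCurv lb B x y z, w⟫ = ⟪bismutCurv lb B (J x) (J y) z, w⟫)) ↔
      (∀ y ∈ N1, ⟪A v, y⟫ = 0) := by
  have hJf : J e2n = -e1 := by rw [← hJe1, hJ2]
  have hlbf : ∀ (s t s' t' : ℝ), ∀ u ∈ N1, ∀ u' ∈ N1,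
      lb (s • e1 + u + t • e2n) (s' • e1 + u' + t' • e2n) =
        (a * (t * s' - t' * s)) • e1 + ((t * s' - t' * s) • v + t • A u' - t' • A u)
          + (0 : ℝ) • e2n := by
    intro s t s' t' u hu u' hu'
    have h0 := hlb0 s s' u hu u' hu'
    have hff : lb e2n e2n = 0 := by
      have h := hanti e2n e2n
      have h2 : (2 : ℝ) • lb e2n e2n = 0 := by
        rw [two_smul]
        nth_rewrite 1 [h]
        exact neg_add_cancel _
      exact (smul_eq_zero.mp h2).resolve_left two_ne_zero
    have h1 : lb e1 e2n = -(a • e1 + v) := by rw [hanti, hlb1]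
    have h2 : lb u e2n = -A u := by rw [hanti, hlb2 u hu]
    rw [map_add (lb _), LinearMap.map_add₂, h0]
    simp only [map_add, map_smul, LinearMap.add_apply, LinearMap.smul_apply, hff, h1, h2, hlb1,
      hlb2 u' hu']
    module
  have hJform : ∀ (s t : ℝ) (u : G),
      J (s • e1 + u + t • e2n) = (-t) • e1 + J u + s • e2n := by
    intro s t u
    simp only [map_add, map_smul, hJe1, hJf]
    module
  have he21 : ⟪e2n, e1⟫ = 0 := by rw [real_inner_comm]; exact he12
  have hN1e1 : ∀ x ∈ N1, ⟪x, e1⟫ = 0 := fun x hx => by rw [real_inner_comm]; exact he1N1 x hx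
  have hN1e2 : ∀ x ∈ N1, ⟪x, e2n⟫ = 0 := fun x hx => by rw [real_inner_comm]; exact he2nN1 x hx
  have hinn : ∀ (s t s' t' : ℝ), ∀ u ∈ N1, ∀ u' ∈ N1,
      ⟪s • e1 + u + t • e2n, s' • e1 + u' + t' • e2n⟫ = s * s' + ⟪u, u'⟫ + t * t' := by
    intro s t s' t' u hu u' hu'
    simp only [inner_add_left, inner_add_right, real_inner_smul_left, real_inner_smul_right,
      he1, he2n, he12, he21, he1N1 u' hu', he2nN1 u' hu', hN1e1 u hu, hN1e2 u hu]
    ring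
  have hJskew : ∀ x y : G, ⟪J x, y⟫ = -⟪x, J y⟫ := by
    intro x y
    have := hJorth x (J y)
    rw [hJ2, inner_neg_right] at this
    linarith
  have hAJs : ∀ x ∈ N1, ∀ y ∈ N1, ⟪A (J x), y⟫ = ⟪A (J y), x⟫ := by
    intro x hx y hy
    rw [hskew _ (hJN1 x hx) y hy, hJskew, hAJ y hy, real_inner_comm]
    ring
  have hBf : ∀ (s t s' t' : ℝ), ∀ u ∈ N1, ∀ u' ∈ N1,
      B (s • e1 + u + t • e2n) (s' • e1 + u' + t' • e2n) =
        (-(a * s + ⟪v, u⟫) * t') • e1 + t • A u' + ((a * s + ⟪v, u⟫) * s') • e2n := by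
    intro s t s' t' u hu u' hu'
    refine ext_inner_right ℝ fun z => ?_
    obtain ⟨p, q, w, hw, rfl⟩ := hspan z
    have key := hB (s • e1 + u + t • e2n) (s' • e1 + u' + t' • e2n) (p • e1 + w + q • e2n)
    have mJu := hJN1 u hu
    have mJu' := hJN1 u' hu'
    have mJw := hJN1 w hw
    have hm : ∀ (c c1 c2 : ℝ), ∀ x ∈ N1, ∀ y ∈ N1, c • v + c1 • A x - c2 • A y ∈ N1 :=
      fun c c1 c2 x hx y hy => N1.sub_mem (N1.add_mem (N1.smul_mem _ hv)
        (N1.smul_mem _ (hAN1 x hx))) (N1.smul_mem _ (hAN1 y hy))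
    rw [hJform, hJform, hJform, hlbf _ _ _ _ _ hu _ hu', hlbf _ _ _ _ _ mJu _ mJu',
      hlbf _ _ _ _ _ hu _ hw, hlbf _ _ _ _ _ mJu _ mJw,
      hlbf _ _ _ _ _ hu' _ hw, hlbf _ _ _ _ _ mJu' _ mJw, inner_sub_left, inner_sub_left (𝕜 := ℝ)
        (x := _ + _ + _) (z := s' • e1 + u' + t' • e2n),
      inner_add_left (𝕜 := ℝ) (z := s • e1 + u + t • e2n) (x := _ + (0:ℝ) • e2n)
        (y := _ + (0:ℝ) • e2n),
      hinn _ _ _ _ _ (hm _ _ _ _ hu' _ hu) _ hw,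
      hinn _ _ _ _ _ (hm _ _ _ _ mJu' _ mJu) _ hw,
      hinn _ _ _ _ _ (hm _ _ _ _ hw _ hu) _ hu',
      hinn _ _ _ _ _ (hm _ _ _ _ mJw _ mJu) _ hu',
      hinn _ _ _ _ _ (hm _ _ _ _ hw _ hu') _ hu,
      hinn _ _ _ _ _ (hm _ _ _ _ mJw _ mJu') _ hu] at key
    rw [hinn _ _ _ _ _ (N1.smul_mem t (hAN1 u' hu')) _ hw, real_inner_smul_left]
    simp only [inner_add_left, inner_sub_left, real_inner_smul_left] at key
    have k1 : ⟪A w, u⟫ = -⟪A u, w⟫ := by rw [hskew w hw u hu, real_inner_comm]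
    have k2 : ⟪A w, u'⟫ = -⟪A u', w⟫ := by rw [hskew w hw u' hu', real_inner_comm]
    have k3 : ⟪A u', u⟫ = -⟪A u, u'⟫ := by rw [hskew u' hu' u hu, real_inner_comm]
    rw [hAJs w hw u hu, hAJs w hw u' hu', hAJs u' hu' u hu, k1, k2, k3] at key
    linarith
  have hR : ∀ (s t s' t' s'' t'' : ℝ), ∀ u ∈ N1, ∀ u' ∈ N1, ∀ u'' ∈ N1,
      bismutCurv lb B (s • e1 + u + t • e2n) (s' • e1 + u' + t' • e2n)
        (s'' • e1 + u'' + t'' • e2n) =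
      -((a * a + ⟪v, v⟫) * (t * s' - t' * s) - t * ⟪A v, u'⟫ + t' * ⟪A v, u⟫) •
        (s'' • e2n - t'' • e1) := by
    intro s t s' t' s'' t'' u hu u' hu' u'' hu''
    have mA := N1.smul_mem t (hAN1 _ hu'')
    have mA' := N1.smul_mem t' (hAN1 _ hu'')
    have hm : (t * s' - t' * s) • v + t • A u' - t' • A u ∈ N1 :=
      N1.sub_mem (N1.add_mem (N1.smul_mem _ hv)
        (N1.smul_mem _ (hAN1 _ hu'))) (N1.smul_mem _ (hAN1 _ hu))
    unfold bismutCurv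
    rw [hBf _ _ _ _ _ hu' _ hu'', hBf _ _ _ _ _ hu _ hu'', hlbf _ _ _ _ _ hu _ hu',
      hBf _ _ _ _ _ hu _ mA', hBf _ _ _ _ _ hu' _ mA, hBf _ _ _ _ _ hm _ hu'',
      inner_sub_right, inner_add_right]
    simp only [real_inner_smul_right, map_smul, hskew v hv u hu, hskew v hv u' hu']
    module
  constructor
  · rintro ⟨h, -⟩ y hy
    have h1 := h ((0:ℝ) • e1 + 0 + (1:ℝ) • e2n) ((1:ℝ) • e1 + 0 + (0:ℝ) • e2n)
      ((0:ℝ) • e1 + y + (0:ℝ) • e2n)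
    have m0 := N1.zero_mem
    rw [hR _ _ _ _ _ _ _ m0 _ m0 _ hy, hR _ _ _ _ _ _ _ m0 _ hy _ m0,
      hR _ _ _ _ _ _ _ hy _ m0 _ m0] at h1
    have h2 := congrArg (fun z => ⟪z, e2n⟫) h1
    have h0 : e2n ≠ 0 := by
      rintro rfl
      simp at he2n
    simpa [inner_add_left, inner_sub_left, real_inner_smul_left, he12, h0] using h2
  · intro h
    constructor
    · intro x y z
      obtain ⟨s, t, u, hu, rfl⟩ := hspan x
      obtain ⟨s', t', u', hu', rfl⟩ := hspan y
      obtain ⟨s'', t'', u'', hu'', rfl⟩ := hspan z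
      rw [hR _ _ _ _ _ _ _ hu _ hu' _ hu'', hR _ _ _ _ _ _ _ hu' _ hu'' _ hu,
        hR _ _ _ _ _ _ _ hu'' _ hu _ hu', h u hu, h u' hu', h u'' hu'']
      module
    · intro x y z w
      obtain ⟨s, t, u, hu, rfl⟩ := hspan x
      obtain ⟨s', t', u', hu', rfl⟩ := hspan y
      obtain ⟨s'', t'', u'', hu'', rfl⟩ := hspan z
      congr 1
      rw [hJform, hJform, hR _ _ _ _ _ _ _ hu _ hu' _ hu'',
        hR _ _ _ _ _ _ _ (hJN1 u hu) _ (hJN1 u' hu') _ hu'', h u hu, h u' hu',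
        h _ (hJN1 u hu), h _ (hJN1 u' hu')]
      module
end

section
/- With the almost abelian Hermitian setup below, assume A ∈ 𝔰𝔬(𝔫₁). Then the torsion of the Bismut connection is given by Tᴮ(e₁, y) = −g(v,y) e₂ₙ and Tᴮ(e₂ₙ, y) = g(v,y) e₁ for y ∈ 𝔫₁, Tᴮ(e₁, e₂ₙ) = v, and Tᴮ(x, y) = 0 for all x, y ∈ 𝔫₁. Consequently the only non-zero components of the torsion 3-form are Tᴮ(e₁, y, e₂ₙ) = −g(v, y) for y ∈ 𝔫₁ (and its permutations). -/
open RealInnerProductSpace Module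

theorem bismut_torsion_almost_abelian_skew
    {G : Type*} [NormedAddCommGroup G] [InnerProductSpace ℝ G] [FiniteDimensional ℝ G]
    (n : ℕ) (hn : 2 ≤ n) (hdim : finrank ℝ G = 2 * n)
    (e1 e2n : G) (N1 : Submodule ℝ G) (hdimN1 : finrank ℝ N1 = 2 * n - 2)
    (he1 : ⟪e1, e1⟫ = 1) (he2n : ⟪e2n, e2n⟫ = 1) (he12 : ⟪e1, e2n⟫ = 0)
    (he1N1 : ∀ x ∈ N1, ⟪e1, x⟫ = 0) (he2nN1 : ∀ x ∈ N1, ⟪e2n, x⟫ = 0)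
    (hspan : ∀ z : G, ∃ (s t : ℝ) (x : G), x ∈ N1 ∧ z = s • e1 + x + t • e2n)
    (J : G →ₗ[ℝ] G)
    (hJorth : ∀ x y : G, ⟪J x, J y⟫ = ⟪x, y⟫)
    (hJ2 : ∀ x : G, J (J x) = -x)
    (hJe1 : J e1 = e2n)
    (hJN1 : ∀ x ∈ N1, J x ∈ N1)
    (a : ℝ) (v : G) (hv : v ∈ N1)
    (A : G →ₗ[ℝ] G) (hAN1 : ∀ x ∈ N1, A x ∈ N1)
    (hAJ : ∀ x ∈ N1, A (J x) = J (A x))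
    (lb : G →ₗ[ℝ] G →ₗ[ℝ] G)
    (hanti : ∀ x y : G, lb x y = - lb y x)
    (hlb1 : lb e2n e1 = a • e1 + v)
    (hlb2 : ∀ x ∈ N1, lb e2n x = A x)
    (hlb0 : ∀ (s t : ℝ), ∀ x ∈ N1, ∀ y ∈ N1, lb (s • e1 + x) (t • e1 + y) = 0)
    (B : G →ₗ[ℝ] G →ₗ[ℝ] G)
    (hB : ∀ x y z : G, 2 * ⟪B x y, z⟫ =
      ⟪lb x y - lb (J x) (J y), z⟫ - ⟪lb x z - lb (J x) (J z), y⟫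
        - ⟪lb y z + lb (J y) (J z), x⟫)
    (hskew : ∀ x ∈ N1, ∀ y ∈ N1, ⟪A x, y⟫ = -⟪x, A y⟫)
    :
    (∀ y ∈ N1, bismutTorsion lb B e1 y = -(⟪v, y⟫ • e2n)) ∧
    (∀ y ∈ N1, bismutTorsion lb B e2n y = ⟪v, y⟫ • e1) ∧
    bismutTorsion lb B e1 e2n = v ∧
    (∀ x ∈ N1, ∀ y ∈ N1, bismutTorsion lb B x y = 0) ∧
    (∀ y ∈ N1, ⟪bismutTorsion lb B e1 y, e2n⟫ = -⟪v, y⟫) := by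
  have hJe2 : J e2n = -e1 := by rw [← hJe1, hJ2]
  have hT : ∀ x y z : G, ⟪bismutTorsion lb B x y, z⟫ =
      -⟪lb (J x) (J y), z⟫ + ⟪lb (J x) (J z), y⟫ - ⟪lb (J y) (J z), x⟫ := by
    intro x y z
    have h1 := hB x y z
    have h2 := hB y x z
    rw [hanti y x, hanti (J y) (J x)] at h2
    simp only [bismutTorsion, inner_sub_left, inner_add_left, inner_neg_left] at *
    linarith
  have hext : ∀ p q : G, ⟪p, e1⟫ = ⟪q, e1⟫ → ⟪p, e2n⟫ = ⟪q, e2n⟫ →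
      (∀ z ∈ N1, ⟪p, z⟫ = ⟪q, z⟫) → p = q := by
    intro p q h1 h2 h3
    refine ext_inner_right ℝ fun z => ?_
    obtain ⟨s, t, x, hx, rfl⟩ := hspan z
    simp only [inner_add_right, inner_smul_right, h1, h2, h3 x hx]
  have l1 : ∀ x ∈ N1, lb e1 x = 0 := fun x hx => by
    simpa using hlb0 1 0 0 N1.zero_mem x hx
  have l2 : ∀ x ∈ N1, lb x e1 = 0 := fun x hx => by
    rw [hanti, l1 x hx, neg_zero]
  have l3 : ∀ x ∈ N1, ∀ y ∈ N1, lb x y = 0 := fun x hx y hy => by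
    simpa using hlb0 0 0 x hx y hy
  have l4 : ∀ x ∈ N1, lb x e2n = -A x := fun x hx => by
    rw [hanti, hlb2 x hx]
  have l5 : lb e1 e2n = -(a • e1 + v) := by rw [hanti, hlb1]
  have l6 : lb e1 e1 = 0 := by
    simpa using hlb0 1 1 0 N1.zero_mem 0 N1.zero_mem
  have l7 : lb e2n e2n = 0 := by
    have h : (2 : ℝ) • lb e2n e2n = 0 := by
      rw [two_smul]; nth_rewrite 1 [hanti]; exact neg_add_cancel _
    exact (smul_eq_zero.mp h).resolve_left two_ne_zero
  have m1 : ‖e1‖ = 1 := by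
    rw [real_inner_self_eq_norm_sq] at he1
    exact by nlinarith [norm_nonneg e1]
  have m2 : ‖e2n‖ = 1 := by rw [← hJe1, ← m1, norm_eq_sqrt_real_inner, hJorth,
    ← norm_eq_sqrt_real_inner]
  have he21 : ⟪e2n, e1⟫ = 0 := by rw [real_inner_comm]; exact he12
  have n1 : ∀ x ∈ N1, ⟪x, e1⟫ = 0 := fun x hx => by
    rw [real_inner_comm]; exact he1N1 x hx
  have n2 : ∀ x ∈ N1, ⟪x, e2n⟫ = 0 := fun x hx => by
    rw [real_inner_comm]; exact he2nN1 x hx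
  have hsym : ∀ y ∈ N1, ∀ z ∈ N1, ⟪J (A y), z⟫ = ⟪J (A z), y⟫ := by
    intro y hy z hz
    have h1 := hJorth (J (A y)) z
    rw [hJ2, inner_neg_left] at h1
    have h2 := hskew _ (hJN1 z hz) y hy
    rw [hAJ z hz] at h2
    rw [h2, real_inner_comm (A y) (J z), ← h1]
  have c1 : ∀ y ∈ N1, bismutTorsion lb B e1 y = -(⟪v, y⟫ • e2n) := by
    intro y hy
    have hJy := hJN1 y hy
    have hAy := hJN1 _ (hAN1 y hy)
    apply hext
    · simp [hT, hJe1, hJe2, l7, hlb2, l4, hAJ, hJy, hy, n1, n2, hAy, he21, inner_smul_left]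
    · simp [hT, hJe1, hJe2, hlb1, hlb2, l2, hAJ, hJy, hy, n1, n2, hAy, m2, inner_smul_left,
        inner_add_left, he1N1]
    · intro z hz
      simp [hT, hJe1, hJe2, hlb2, l3, hAJ, hJy, hJN1, hy, hz, he2nN1, inner_smul_left,
        hsym y hy z hz]
  refine ⟨c1, ?_, ?_, ?_, ?_⟩
  · intro y hy
    have hJy := hJN1 y hy
    have hAy := hJN1 _ (hAN1 y hy)
    apply hext
    · simp [hT, hJe1, hJe2, l1, l4, l5, hAJ, hJy, hy, n1, n2, hAy, m1, he1N1, inner_smul_left,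
        inner_add_left]
    · simp [hT, hJe1, hJe2, l1, l2, l6, hJy, he12, inner_smul_left]
    · intro z hz
      simp [hT, hJe2, l1, l3, hJy, hJN1, hz, he1N1, inner_smul_left]
  · apply hext
    · simp [hT, hJe1, hJe2, hlb1, l5, l7, n1, hv, he1, inner_smul_left, inner_add_left]
    · simp [hT, hJe1, hJe2, hlb1, l6, n2, hv, he12, inner_smul_left, inner_add_left]
    · intro z hz
      have hAz := hJN1 _ (hAN1 z hz)
      simp [hT, hJe1, hJe2, hlb1, hlb2, l1, hJN1, hz, hAJ, hAz, n2, he1N1, inner_smul_left,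
        inner_add_left]
  · intro x hx y hy
    have hJx := hJN1 x hx
    have hJy := hJN1 y hy
    apply hext
    · simp [hT, hJe1, l3, l4, hJx, hJy, hAJ, hx, hy, hsym x hx y hy]
    · simp [hT, hJe2, l2, l3, hJx, hJy]
    · intro z hz
      simp [hT, l3, hJx, hJy, hJN1, hz]
  · intro y hy
    rw [c1 y hy, inner_neg_left, inner_smul_left, he2n]
    simp
end

section
/- With the almost abelian Hermitian setup below, assume A ∈ 𝔰𝔬(𝔫₁) and g(Av, y) = 0 for every y ∈ 𝔫₁ (the Bismut Kähler-like condition). Then the torsion 3-form of the Bismut connection is parallel: (∇ᴮ_u Tᴮ)(x, y, z) = 0 for all u, x, y, z ∈ 𝔤. -/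
open RealInnerProductSpace Module

theorem bismut_torsion_parallel_almost_abelian
    {G : Type*} [NormedAddCommGroup G] [InnerProductSpace ℝ G] [FiniteDimensional ℝ G]
    (n : ℕ) (hn : 2 ≤ n) (hdim : finrank ℝ G = 2 * n)
    (e1 e2n : G) (N1 : Submodule ℝ G) (hdimN1 : finrank ℝ N1 = 2 * n - 2)
    (he1 : ⟪e1, e1⟫ = 1) (he2n : ⟪e2n, e2n⟫ = 1) (he12 : ⟪e1, e2n⟫ = 0)
    (he1N1 : ∀ x ∈ N1, ⟪e1, x⟫ = 0) (he2nN1 : ∀ x ∈ N1, ⟪e2n, x⟫ = 0)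
    (hspan : ∀ z : G, ∃ (s t : ℝ) (x : G), x ∈ N1 ∧ z = s • e1 + x + t • e2n)
    (J : G →ₗ[ℝ] G)
    (hJorth : ∀ x y : G, ⟪J x, J y⟫ = ⟪x, y⟫)
    (hJ2 : ∀ x : G, J (J x) = -x)
    (hJe1 : J e1 = e2n)
    (hJN1 : ∀ x ∈ N1, J x ∈ N1)
    (a : ℝ) (v : G) (hv : v ∈ N1)
    (A : G →ₗ[ℝ] G) (hAN1 : ∀ x ∈ N1, A x ∈ N1)
    (hAJ : ∀ x ∈ N1, A (J x) = J (A x))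
    (lb : G →ₗ[ℝ] G →ₗ[ℝ] G)
    (hanti : ∀ x y : G, lb x y = - lb y x)
    (hlb1 : lb e2n e1 = a • e1 + v)
    (hlb2 : ∀ x ∈ N1, lb e2n x = A x)
    (hlb0 : ∀ (s t : ℝ), ∀ x ∈ N1, ∀ y ∈ N1, lb (s • e1 + x) (t • e1 + y) = 0)
    (B : G →ₗ[ℝ] G →ₗ[ℝ] G)
    (hB : ∀ x y z : G, 2 * ⟪B x y, z⟫ =
      ⟪lb x y - lb (J x) (J y), z⟫ - ⟪lb x z - lb (J x) (J z), y⟫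
        - ⟪lb y z + lb (J y) (J z), x⟫)
    (hskew : ∀ x ∈ N1, ∀ y ∈ N1, ⟪A x, y⟫ = -⟪x, A y⟫)
    (hKL : ∀ y ∈ N1, ⟪A v, y⟫ = 0)
    :
    ∀ u x y z : G,
      -⟪bismutTorsion lb B (B u x) y, z⟫ - ⟪bismutTorsion lb B x (B u y), z⟫
        - ⟪bismutTorsion lb B x y, B u z⟫ = 0 := by
  have he21 : ⟪e2n, e1⟫ = 0 := by rw [real_inner_comm]; exact he12
  have hN1e : ∀ x ∈ N1, ⟪x, e1⟫ = 0 := fun x hx => by rw [real_inner_comm]; exact he1N1 x hx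
  have hN2e : ∀ x ∈ N1, ⟪x, e2n⟫ = 0 := fun x hx => by rw [real_inner_comm]; exact he2nN1 x hx
  have hJe2 : J e2n = -e1 := by rw [← hJe1, hJ2]
  have hlbN : ∀ x ∈ N1, ∀ y ∈ N1, lb x y = 0 := fun x hx y hy => by
    simpa using hlb0 0 0 x hx y hy
  have hlbe : ∀ y ∈ N1, lb e1 y = 0 := fun y hy => by
    simpa using hlb0 1 0 0 N1.zero_mem y hy
  have hlbe' : ∀ y ∈ N1, lb y e1 = 0 := fun y hy => by
    rw [hanti, hlbe y hy, neg_zero]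
  have hlbee : lb e1 e1 = 0 := by
    simpa using hlb0 1 1 0 N1.zero_mem 0 N1.zero_mem
  have hself : lb e2n e2n = 0 := by
    have h := hanti e2n e2n
    have h2 : (2 : ℝ) • lb e2n e2n = 0 := by
      rw [two_smul]
      nth_rewrite 1 [h]
      exact neg_add_cancel _
    simpa using h2
  have hlb1' : lb e1 e2n = -(a • e1 + v) := by rw [hanti, hlb1]
  have hlb2' : ∀ x ∈ N1, lb x e2n = -A x := fun x hx => by rw [hanti, hlb2 x hx]
  have hL : ∀ (s t s' t' : ℝ), ∀ X ∈ N1, ∀ Y ∈ N1,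
      lb (s • e1 + X + t • e2n) (s' • e1 + Y + t' • e2n)
        = (t * s' - t' * s) • (a • e1 + v) + t • A Y - t' • A X := by
    intro s t s' t' X hX Y hY
    simp only [map_add, map_smul, LinearMap.add_apply, LinearMap.smul_apply, hlbN X hX Y hY,
      hlbe Y hY, hlbe' X hX, hlbee, hself, hlb1, hlb1', hlb2 Y hY, hlb2' X hX]
    module
  have hJf : ∀ (s t : ℝ) (X : G),
      J (s • e1 + X + t • e2n) = (-t) • e1 + J X + s • e2n := by
    intro s t X
    simp only [map_add, map_smul, hJe1, hJe2]
    module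
  have hsym : ∀ x ∈ N1, ∀ y ∈ N1, ⟪A (J x), y⟫ = ⟪A (J y), x⟫ := by
    intro x hx y hy
    have h1 : ⟪J (A x), J (J y)⟫ = ⟪A x, J y⟫ := hJorth _ _
    have h2 := hskew x hx (J y) (hJN1 y hy)
    rw [hJ2, inner_neg_right] at h1
    rw [hAJ x hx, real_inner_comm x]
    linarith
  have hskew' : ∀ x ∈ N1, ∀ y ∈ N1, ⟪A x, y⟫ = -⟪A y, x⟫ := by
    intro x hx y hy
    rw [hskew x hx y hy, real_inner_comm x]
  have hBf : ∀ (s t s' t' : ℝ), ∀ X ∈ N1, ∀ Y ∈ N1,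
      B (s • e1 + X + t • e2n) (s' • e1 + Y + t' • e2n)
        = (-((a * s + ⟪v, X⟫) * t')) • e1 + t • A Y + ((a * s + ⟪v, X⟫) * s') • e2n := by
    intro s t s' t' X hX Y hY
    apply ext_inner_right ℝ
    intro z
    obtain ⟨p, q, Z, hZ, rfl⟩ := hspan z
    have h := hB (s • e1 + X + t • e2n) (s' • e1 + Y + t' • e2n) (p • e1 + Z + q • e2n)
    have jX := hJN1 X hX
    have jY := hJN1 Y hY
    have jZ := hJN1 Z hZ
    rw [hJf, hJf, hJf, hL _ _ _ _ _ hX _ hY, hL _ _ _ _ _ hX _ hZ, hL _ _ _ _ _ hY _ hZ,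
      hL _ _ _ _ _ jX _ jY, hL _ _ _ _ _ jX _ jZ, hL _ _ _ _ _ jY _ jZ] at h
    generalize B (s • e1 + X + t • e2n) (s' • e1 + Y + t' • e2n) = W at h ⊢
    have k1 := hsym X hX Y hY
    have k2 := hsym X hX Z hZ
    have k3 := hsym Y hY Z hZ
    have l1 := hskew' X hX Y hY
    have l2 := hskew' X hX Z hZ
    have l3 := hskew' Y hY Z hZ
    generalize hR : ⟪W, p • e1 + Z + q • e2n⟫ = R at h ⊢
    simp only [inner_add_left, inner_add_right, inner_sub_left, inner_smul_left,
      inner_smul_right, he1, he2n, he12, he21, he1N1 X hX, he1N1 Y hY, he1N1 Z hZ,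
      he2nN1 X hX, he2nN1 Y hY, he2nN1 Z hZ, hN1e v hv, hN2e v hv,
      hN1e _ (hAN1 X hX), hN1e _ (hAN1 Y hY), hN1e _ (hAN1 Z hZ),
      hN2e _ (hAN1 X hX), hN2e _ (hAN1 Y hY), hN2e _ (hAN1 Z hZ),
      hN1e _ (hAN1 _ jX), hN1e _ (hAN1 _ jY), hN1e _ (hAN1 _ jZ),
      hN2e _ (hAN1 _ jX), hN2e _ (hAN1 _ jY), hN2e _ (hAN1 _ jZ),
      conj_trivial, k1, k2, k3, l1, l2, l3] at h ⊢
    linarith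
  have hAv : ∀ X ∈ N1, ⟪v, A X⟫ = 0 := fun X hX => by
    have h1 := hskew v hv X hX
    rw [hKL X hX] at h1
    linarith
  have hT : ∀ (s t s' t' p q : ℝ), ∀ X ∈ N1, ∀ Y ∈ N1, ∀ Z ∈ N1,
      ⟪bismutTorsion lb B (s • e1 + X + t • e2n) (s' • e1 + Y + t' • e2n),
        p • e1 + Z + q • e2n⟫
      = ⟪v, X⟫ * (s' * q - t' * p) - ⟪v, Y⟫ * (s * q - t * p)
        + ⟪v, Z⟫ * (s * t' - t * s') := by
    intro s t s' t' p q X hX Y hY Z hZ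
    unfold bismutTorsion
    rw [hBf _ _ _ _ _ hX _ hY, hBf _ _ _ _ _ hY _ hX, hL _ _ _ _ _ hX _ hY]
    simp only [inner_add_left, inner_add_right, inner_sub_left, inner_smul_left,
      inner_smul_right, he1, he2n, he12, he21, he1N1 Z hZ, he2nN1 Z hZ, hN1e v hv, hN2e v hv,
      hN1e _ (hAN1 X hX), hN1e _ (hAN1 Y hY), hN2e _ (hAN1 X hX), hN2e _ (hAN1 Y hY),
      conj_trivial]
    ring
  intro u x y z
  obtain ⟨u1, u2, U, hU, rfl⟩ := hspan u
  obtain ⟨x1, x2, X, hX, rfl⟩ := hspan x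
  obtain ⟨y1, y2, Y, hY, rfl⟩ := hspan y
  obtain ⟨z1, z2, Z, hZ, rfl⟩ := hspan z
  have aX := N1.smul_mem u2 (hAN1 X hX)
  have aY := N1.smul_mem u2 (hAN1 Y hY)
  have aZ := N1.smul_mem u2 (hAN1 Z hZ)
  rw [hBf _ _ _ _ _ hU _ hX, hBf _ _ _ _ _ hU _ hY, hBf _ _ _ _ _ hU _ hZ,
    hT _ _ _ _ _ _ _ aX _ hY _ hZ, hT _ _ _ _ _ _ _ hX _ aY _ hZ,
    hT _ _ _ _ _ _ _ hX _ hY _ aZ]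
  simp only [inner_smul_right, hAv X hX, hAv Y hY, hAv Z hZ]
  ring
end

section
/- With the almost abelian Hermitian setup below (for arbitrary a ∈ ℝ, v ∈ 𝔫₁ and endomorphism A of 𝔫₁ commuting with J|_{𝔫₁}), one has g(Rᴮ(e₂ₙ, e₁)e₁, e₂ₙ) = −(a² + |v|²). Equivalently, Gᴮ(e₁, e₁, e₂ₙ, e₂ₙ) := Rᴮ(e₁, e₁, e₂ₙ, e₂ₙ) − Rᴮ(e₂ₙ, e₁, e₁, e₂ₙ) = a² + |v|². -/
open RealInnerProductSpace Module

theorem bismut_curvature_G_component_almost_abelian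
    {G : Type*} [NormedAddCommGroup G] [InnerProductSpace ℝ G] [FiniteDimensional ℝ G]
    (n : ℕ) (hn : 2 ≤ n) (hdim : finrank ℝ G = 2 * n)
    (e1 e2n : G) (N1 : Submodule ℝ G) (hdimN1 : finrank ℝ N1 = 2 * n - 2)
    (he1 : ⟪e1, e1⟫ = 1) (he2n : ⟪e2n, e2n⟫ = 1) (he12 : ⟪e1, e2n⟫ = 0)
    (he1N1 : ∀ x ∈ N1, ⟪e1, x⟫ = 0) (he2nN1 : ∀ x ∈ N1, ⟪e2n, x⟫ = 0)
    (hspan : ∀ z : G, ∃ (s t : ℝ) (x : G), x ∈ N1 ∧ z = s • e1 + x + t • e2n)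
    (J : G →ₗ[ℝ] G)
    (hJorth : ∀ x y : G, ⟪J x, J y⟫ = ⟪x, y⟫)
    (hJ2 : ∀ x : G, J (J x) = -x)
    (hJe1 : J e1 = e2n)
    (hJN1 : ∀ x ∈ N1, J x ∈ N1)
    (a : ℝ) (v : G) (hv : v ∈ N1)
    (A : G →ₗ[ℝ] G) (hAN1 : ∀ x ∈ N1, A x ∈ N1)
    (hAJ : ∀ x ∈ N1, A (J x) = J (A x))
    (lb : G →ₗ[ℝ] G →ₗ[ℝ] G)
    (hanti : ∀ x y : G, lb x y = - lb y x)
    (hlb1 : lb e2n e1 = a • e1 + v)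
    (hlb2 : ∀ x ∈ N1, lb e2n x = A x)
    (hlb0 : ∀ (s t : ℝ), ∀ x ∈ N1, ∀ y ∈ N1, lb (s • e1 + x) (t • e1 + y) = 0)
    (B : G →ₗ[ℝ] G →ₗ[ℝ] G)
    (hB : ∀ x y z : G, 2 * ⟪B x y, z⟫ =
      ⟪lb x y - lb (J x) (J y), z⟫ - ⟪lb x z - lb (J x) (J z), y⟫
        - ⟪lb y z + lb (J y) (J z), x⟫)
    :
    ⟪bismutCurv lb B e2n e1 e1, e2n⟫ = -(a ^ 2 + ‖v‖ ^ 2) ∧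
    ⟪bismutCurv lb B e1 e1 e2n, e2n⟫ - ⟪bismutCurv lb B e2n e1 e1, e2n⟫ =
      a ^ 2 + ‖v‖ ^ 2 := by
  have hJf : J e2n = -e1 := by rw [← hJe1, hJ2]
  have hself : ∀ x, lb x x = 0 := fun x => by
    have h : (2 : ℝ) • lb x x = 0 := by
      rw [two_smul]
      nth_rewrite 1 [hanti x x]
      exact neg_add_cancel _
    exact (smul_eq_zero.mp h).resolve_left two_ne_zero
  have he21 : ⟪e2n, e1⟫ = 0 := by rw [real_inner_comm]; exact he12
  have hN1e : ∀ x ∈ N1, ⟪x, e1⟫ = 0 := fun x hx => by rw [real_inner_comm]; exact he1N1 x hx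
  have hN1f : ∀ x ∈ N1, ⟪x, e2n⟫ = 0 := fun x hx => by rw [real_inner_comm]; exact he2nN1 x hx
  have hlbe : ∀ x ∈ N1, lb e1 x = 0 := fun x hx => by
    simpa using hlb0 1 0 0 N1.zero_mem x hx
  have hlbe' : ∀ x ∈ N1, lb x e1 = 0 := fun x hx => by rw [hanti, hlbe x hx, neg_zero]
  have hlbf : ∀ x ∈ N1, lb x e2n = -A x := fun x hx => by rw [hanti, hlb2 x hx]
  have hef : lb e1 e2n = -(a • e1 + v) := by rw [hanti, hlb1]
  have hfw : ∀ w, ⟪lb e2n w, e2n⟫ = 0 := by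
    intro w
    obtain ⟨s, t, x, hx, rfl⟩ := hspan w
    simp [hlb1, hlb2 x hx, hself, inner_add_left, inner_smul_left, he12, hN1f v hv,
      hN1f _ (hAN1 x hx)]
  -- `g(B_f w, f) = 0`
  have h1 : ∀ w, ⟪B e2n w, e2n⟫ = 0 := by
    intro w
    have h := hB e2n w e2n
    rw [hJf, hself, hself, hanti w e2n, hanti (J w) (-e1)] at h
    simp only [map_neg, LinearMap.neg_apply, inner_sub_left, inner_add_left, inner_neg_left,
      inner_zero_left, hfw] at h
    linarith
  -- `B_f e = 0`
  have h2 : B e2n e1 = 0 := by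
    refine inner_self_eq_zero (𝕜 := ℝ).mp ?_
    have key : ∀ z, ⟪B e2n e1, z⟫ = 0 := by
      intro z
      have h := hB e2n e1 z
      obtain ⟨s, t, x, hx, rfl⟩ := hspan z
      have hJx := hJN1 x hx
      simp [hJf, hJe1, hself, hlb1, hef, hlb2 x hx, hlb2 _ hJx, hlbe x hx, hlbe _ hJx,
        inner_add_left, inner_sub_left, inner_add_right, inner_smul_left, inner_smul_right,
        he1, he2n, he12, he21, hN1e _ (hAN1 x hx), hN1f _ (hAN1 _ hJx), hN1f v hv, hN1e v hv] at h
      simp only [inner_add_right, inner_smul_right]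
      linarith
    exact key _
  have h3 : ⟪B e1 e1, e2n⟫ = a := by
    have h := hB e1 e1 e2n
    simp [hJf, hJe1, hself, hlb1, hef, inner_add_left, inner_sub_left, inner_smul_left,
      he1, he2n, he12, he21, hN1f v hv, hN1e v hv] at h
    rw [← real_inner_self_eq_norm_sq, he1] at h
    linarith
  have h4 : ⟪B v e1, e2n⟫ = ‖v‖ ^ 2 := by
    have h := hB v e1 e2n
    have hJv := hJN1 v hv
    simp [hJf, hJe1, hself, hlb1, hef, hlbe' v hv, hlbe' _ hJv, hlbf v hv, hlbf _ hJv,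
      inner_add_left, inner_sub_left, inner_smul_left,
      he1, he2n, he12, he21, hN1f v hv, hN1e v hv, he1N1 v hv, hN1e _ (hAN1 v hv),
      hN1f _ (hAN1 _ hJv)] at h
    linarith
  have hR : ⟪bismutCurv lb B e2n e1 e1, e2n⟫ = -(a ^ 2 + ‖v‖ ^ 2) := by
    simp only [bismutCurv, h2, hlb1, map_zero, map_add, map_smul, LinearMap.add_apply,
      LinearMap.smul_apply, inner_sub_left, inner_add_left, real_inner_smul_left, h1, h3, h4,
      inner_zero_left]
    ring
  refine ⟨hR, ?_⟩
  rw [hR]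
  simp [bismutCurv, hself]
end

section
/- With the almost abelian Hermitian setup below, assume a = 0 and v = 0. Then Rᴮ(x, e₁, e₁, x) = 0 for every x ∈ 𝔫₁ if and only if S(A) = 0, i.e., if and only if A ∈ 𝔰𝔬(𝔫₁). -/
open RealInnerProductSpace Module

theorem bismut_curvature_vanishing_iff_skew
    {G : Type*} [NormedAddCommGroup G] [InnerProductSpace ℝ G] [FiniteDimensional ℝ G]
    (n : ℕ) (hn : 2 ≤ n) (hdim : finrank ℝ G = 2 * n)
    (e1 e2n : G) (N1 : Submodule ℝ G) (hdimN1 : finrank ℝ N1 = 2 * n - 2)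
    (he1 : ⟪e1, e1⟫ = 1) (he2n : ⟪e2n, e2n⟫ = 1) (he12 : ⟪e1, e2n⟫ = 0)
    (he1N1 : ∀ x ∈ N1, ⟪e1, x⟫ = 0) (he2nN1 : ∀ x ∈ N1, ⟪e2n, x⟫ = 0)
    (hspan : ∀ z : G, ∃ (s t : ℝ) (x : G), x ∈ N1 ∧ z = s • e1 + x + t • e2n)
    (J : G →ₗ[ℝ] G)
    (hJorth : ∀ x y : G, ⟪J x, J y⟫ = ⟪x, y⟫)
    (hJ2 : ∀ x : G, J (J x) = -x)
    (hJe1 : J e1 = e2n)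
    (hJN1 : ∀ x ∈ N1, J x ∈ N1)
    (a : ℝ) (v : G) (hv : v ∈ N1)
    (A : G →ₗ[ℝ] G) (hAN1 : ∀ x ∈ N1, A x ∈ N1)
    (hAJ : ∀ x ∈ N1, A (J x) = J (A x))
    (lb : G →ₗ[ℝ] G →ₗ[ℝ] G)
    (hanti : ∀ x y : G, lb x y = - lb y x)
    (hlb1 : lb e2n e1 = a • e1 + v)
    (hlb2 : ∀ x ∈ N1, lb e2n x = A x)
    (hlb0 : ∀ (s t : ℝ), ∀ x ∈ N1, ∀ y ∈ N1, lb (s • e1 + x) (t • e1 + y) = 0)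
    (B : G →ₗ[ℝ] G →ₗ[ℝ] G)
    (hB : ∀ x y z : G, 2 * ⟪B x y, z⟫ =
      ⟪lb x y - lb (J x) (J y), z⟫ - ⟪lb x z - lb (J x) (J z), y⟫
        - ⟪lb y z + lb (J y) (J z), x⟫)
    (ha : a = 0) (hv0 : v = 0)
    :
    (∀ x ∈ N1, ⟪bismutCurv lb B x e1 e1, x⟫ = 0) ↔
      (∀ x ∈ N1, ∀ y ∈ N1, ⟪A x, y⟫ = -⟪x, A y⟫) := by
  subst ha hv0
  have hfe : lb e2n e1 = 0 := by rw [hlb1]; simp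
  have hef : lb e1 e2n = 0 := by rw [hanti, hfe, neg_zero]
  have hee : lb e1 e1 = 0 := by simpa using hlb0 1 1 0 N1.zero_mem 0 N1.zero_mem
  have hff : lb e2n e2n = 0 := by
    have h := hanti e2n e2n
    have h2 : (2 : ℝ) • lb e2n e2n = 0 := by
      rw [two_smul]; exact eq_neg_iff_add_eq_zero.mp h
    exact (smul_eq_zero.mp h2).resolve_left two_ne_zero
  have hxy : ∀ x ∈ N1, ∀ y ∈ N1, lb x y = 0 := fun x hx y hy => by
    simpa using hlb0 0 0 x hx y hy
  have hex : ∀ x ∈ N1, lb e1 x = 0 := fun x hx => by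
    simpa using hlb0 1 0 0 N1.zero_mem x hx
  have hxe : ∀ x ∈ N1, lb x e1 = 0 := fun x hx => by rw [hanti, hex x hx, neg_zero]
  have hxf : ∀ x ∈ N1, lb x e2n = - A x := fun x hx => by rw [hanti, hlb2 x hx]
  have hJf : J e2n = -e1 := by rw [← hJe1, hJ2]
  have he21 : ⟪e2n, e1⟫ = 0 := by rw [real_inner_comm]; exact he12
  have hNe1 : ∀ x ∈ N1, ⟪x, e1⟫ = 0 := fun x hx => by rw [real_inner_comm]; exact he1N1 x hx
  have hNe2 : ∀ x ∈ N1, ⟪x, e2n⟫ = 0 := fun x hx => by rw [real_inner_comm]; exact he2nN1 x hx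
  have hlez : ∀ z, lb e1 z = 0 := fun z => by
    obtain ⟨s, t, y, hy, rfl⟩ := hspan z
    simp [hee, hex y hy, hef]
  have hBee : B e1 e1 = 0 := by
    apply ext_inner_right ℝ
    intro z
    have h := hB e1 e1 z
    simp only [hJe1, hlez, hff] at h
    simp at h
    simpa using h
  have key : ∀ x ∈ N1, ∀ z ∈ N1, 2 * ⟪B x e1, z⟫ = ⟪A (J x), z⟫ - ⟪A (J z), x⟫ := by
    intro x hx z hz
    rw [hB, hJe1, hxe x hx, hxf _ (hJN1 x hx), hxy x hx z hz, hxy _ (hJN1 x hx) _ (hJN1 z hz),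
      hlez, hlb2 _ (hJN1 z hz)]
    simp
  have mem : ∀ x ∈ N1, B x e1 ∈ N1 := by
    intro x hx
    have h1 : ⟪B x e1, e1⟫ = 0 := by
      have h := hB x e1 e1
      rw [hJe1, hxe x hx, hxf _ (hJN1 x hx), hee, hff] at h
      simpa [inner_neg_left, hNe1 _ (hAN1 _ (hJN1 x hx))] using h
    have h2 : ⟪B x e1, e2n⟫ = 0 := by
      have h := hB x e1 e2n
      rw [hJf, hJe1, hxe x hx, hxf _ (hJN1 x hx), hxf x hx, hef] at h
      simpa [inner_neg_left, hNe2 _ (hAN1 _ (hJN1 x hx)), hNe1 _ (hAN1 _ hx),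
        hxe _ (hJN1 x hx), hfe] using h
    obtain ⟨s, t, y, hy, hz⟩ := hspan (B x e1)
    rw [hz] at h1 h2 ⊢
    simp only [inner_add_left, real_inner_smul_left, he1, he21, he12, he2n, hNe1 y hy,
      hNe2 y hy] at h1 h2
    have hs : s = 0 := by linarith
    have ht : t = 0 := by linarith
    simpa [hs, ht] using hy
  have curv : ∀ x ∈ N1, ⟪bismutCurv lb B x e1 e1, x⟫ = -⟪B x e1, B x e1⟫ := by
    intro x hx
    have hw := mem x hx
    have h1 := key x hx _ hw
    have h2 := hB e1 (B x e1) x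
    rw [hJe1, hlez, hlez, hlb2 _ (hJN1 _ hw), hlb2 _ (hJN1 _ hx), hxy _ hw _ hx,
      hxy _ (hJN1 _ hw) _ (hJN1 _ hx)] at h2
    simp only [zero_sub, inner_neg_left, add_zero, inner_zero_left] at h2
    simp only [bismutCurv, hBee, hxe x hx, map_zero, LinearMap.zero_apply, sub_zero, zero_sub,
      inner_neg_left]
    linarith
  constructor
  · intro h x hx y hy
    have hw : B x e1 = 0 := by
      have h1 := curv x hx
      rw [h x hx] at h1
      exact inner_self_eq_zero.mp (by linarith : ⟪B x e1, B x e1⟫ = 0)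
    have h1 := key x hx _ (hJN1 y hy)
    rw [hw, hJ2, hAJ x hx, hJorth] at h1
    simp only [inner_zero_left, map_neg, inner_neg_left] at h1
    rw [real_inner_comm]
    rw [real_inner_comm] at h1
    have := real_inner_comm x (A y)
    have := real_inner_comm y (A x)
    linarith
  · intro h x hx
    have hw := mem x hx
    have h1 := key x hx _ hw
    have h2 := h (J x) (hJN1 x hx) (B x e1) hw
    have h3 := hJorth (J x) (A (B x e1))
    rw [hJ2, ← hAJ _ hw, inner_neg_left] at h3
    have h4 := real_inner_comm x (A (J (B x e1)))
    rw [curv x hx]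
    linarith
end

section
/- With the almost abelian Hermitian setup below, the Bismut curvature satisfies the symmetry Rᴮ(x, y, z, w) = Rᴮ(z, y, x, w) for all x, y, z, w ∈ 𝔤 if and only if a = 0, v = 0 and A ∈ 𝔰𝔬(𝔫₁). -/
open RealInnerProductSpace Module

set_option linter.unusedSimpArgs false

theorem bismut_curvature_symmetry13_iff
    {G : Type*} [NormedAddCommGroup G] [InnerProductSpace ℝ G] [FiniteDimensional ℝ G]
    (n : ℕ) (hn : 2 ≤ n) (hdim : finrank ℝ G = 2 * n)
    (e1 e2n : G) (N1 : Submodule ℝ G) (hdimN1 : finrank ℝ N1 = 2 * n - 2)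
    (he1 : ⟪e1, e1⟫ = 1) (he2n : ⟪e2n, e2n⟫ = 1) (he12 : ⟪e1, e2n⟫ = 0)
    (he1N1 : ∀ x ∈ N1, ⟪e1, x⟫ = 0) (he2nN1 : ∀ x ∈ N1, ⟪e2n, x⟫ = 0)
    (hspan : ∀ z : G, ∃ (s t : ℝ) (x : G), x ∈ N1 ∧ z = s • e1 + x + t • e2n)
    (J : G →ₗ[ℝ] G)
    (hJorth : ∀ x y : G, ⟪J x, J y⟫ = ⟪x, y⟫)
    (hJ2 : ∀ x : G, J (J x) = -x)
    (hJe1 : J e1 = e2n)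
    (hJN1 : ∀ x ∈ N1, J x ∈ N1)
    (a : ℝ) (v : G) (hv : v ∈ N1)
    (A : G →ₗ[ℝ] G) (hAN1 : ∀ x ∈ N1, A x ∈ N1)
    (hAJ : ∀ x ∈ N1, A (J x) = J (A x))
    (lb : G →ₗ[ℝ] G →ₗ[ℝ] G)
    (hanti : ∀ x y : G, lb x y = - lb y x)
    (hlb1 : lb e2n e1 = a • e1 + v)
    (hlb2 : ∀ x ∈ N1, lb e2n x = A x)
    (hlb0 : ∀ (s t : ℝ), ∀ x ∈ N1, ∀ y ∈ N1, lb (s • e1 + x) (t • e1 + y) = 0)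
    (B : G →ₗ[ℝ] G →ₗ[ℝ] G)
    (hB : ∀ x y z : G, 2 * ⟪B x y, z⟫ =
      ⟪lb x y - lb (J x) (J y), z⟫ - ⟪lb x z - lb (J x) (J z), y⟫
        - ⟪lb y z + lb (J y) (J z), x⟫)
    :
    (∀ x y z w : G, ⟪bismutCurv lb B x y z, w⟫ = ⟪bismutCurv lb B z y x, w⟫) ↔
      (a = 0 ∧ v = 0 ∧ ∀ x ∈ N1, ∀ y ∈ N1, ⟪A x, y⟫ = -⟪x, A y⟫) := by
  have hJf : J e2n = -e1 := by rw [← hJe1, hJ2]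
  have hee : lb e1 e1 = 0 := by
    simpa using hlb0 1 1 0 N1.zero_mem 0 N1.zero_mem
  have hyy : ∀ y : G, lb y y = 0 := by
    intro y
    have h : (2 : ℝ) • lb y y = 0 := by
      rw [two_smul]
      exact eq_neg_iff_add_eq_zero.mp (hanti y y)
    exact (smul_eq_zero.mp h).resolve_left two_ne_zero
  have hff : lb e2n e2n = 0 := hyy e2n
  have hef : lb e1 e2n = -(a • e1 + v) := by rw [hanti, hlb1]
  have hex : ∀ x ∈ N1, lb e1 x = 0 := fun x hx => by
    simpa using hlb0 1 0 0 N1.zero_mem x hx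
  have hxe : ∀ x ∈ N1, lb x e1 = 0 := fun x hx => by
    simpa using hlb0 0 1 x hx 0 N1.zero_mem
  have hxx : ∀ x ∈ N1, ∀ y ∈ N1, lb x y = 0 := fun x hx y hy => by
    simpa using hlb0 0 0 x hx y hy
  have hxf : ∀ x ∈ N1, lb x e2n = - A x := fun x hx => by rw [hanti, hlb2 x hx]
  have he21 : ⟪e2n, e1⟫ = 0 := by rw [real_inner_comm]; exact he12
  have hN1e : ∀ x ∈ N1, ⟪x, e1⟫ = 0 := fun x hx => by
    rw [real_inner_comm]; exact he1N1 x hx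
  have hN1f : ∀ x ∈ N1, ⟪x, e2n⟫ = 0 := fun x hx => by
    rw [real_inner_comm]; exact he2nN1 x hx
  have hskew : ∀ x y z : G, ⟪B x y, z⟫ = -⟪y, B x z⟫ := by
    intro x y z
    have h1 := hB x y z
    have h2 := hB x z y
    rw [hanti z y, hanti (J z) (J y), real_inner_comm] at h2
    have h3 : ⟪-lb y z + -lb (J y) (J z), x⟫ = -⟪lb y z + lb (J y) (J z), x⟫ := by
      rw [← inner_neg_left]; congr 1; abel
    rw [h3] at h2
    linarith
  have hself : ∀ y z : G, bismutCurv lb B y y z = 0 := by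
    intro y z
    have h : lb y y = 0 := hyy y
    simp [bismutCurv, h]
  have hzero : ∀ u : G, (∀ z, ⟪u, z⟫ = 0) → u = 0 := fun u hu =>
    (inner_self_eq_zero (𝕜 := ℝ)).mp (hu u)
  constructor
  · intro hR
    have hBfe : B e2n e1 = 0 := by
      apply hzero
      intro z
      obtain ⟨s, t, w, hw, rfl⟩ := hspan z
      have h := hB e2n e1 (s • e1 + w + t • e2n)
      simp [inner_add_left, inner_add_right, inner_sub_left, inner_smul_left, inner_smul_right,
        hJf, hJe1, hee, hff, hef, hlb1, hlb2 _ hw, hex _ hw, hlb2 _ (hJN1 w hw), hex _ (hJN1 w hw),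
        hN1e _ (hAN1 w hw), hN1f _ (hAN1 _ (hJN1 w hw)), hN1e v hv, hN1f v hv,
        he12, he21, he1, he2n] at h ⊢
      linarith
    have hBff : B e2n e2n = 0 := by
      apply hzero
      intro z
      obtain ⟨s, t, w, hw, rfl⟩ := hspan z
      have h := hB e2n e2n (s • e1 + w + t • e2n)
      simp [inner_add_left, inner_add_right, inner_sub_left, inner_smul_left, inner_smul_right,
        hJf, hJe1, hee, hff, hef, hlb1, hlb2 _ hw, hex _ hw, hlb2 _ (hJN1 w hw), hex _ (hJN1 w hw),
        hN1f _ (hAN1 w hw), hN1f _ (hAN1 _ (hJN1 w hw)), hN1e v hv, hN1f v hv,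
        he12, he21, he1, he2n] at h ⊢
      linarith
    have hBee : ⟪B e1 e1, e2n⟫ = a := by
      have h := hB e1 e1 e2n
      simp [inner_add_left, inner_sub_left, inner_smul_left,
        hJf, hJe1, hee, hff, hef, hlb1, hN1e v hv, hN1f v hv,
        he12, he21, he1, he2n] at h
      rw [← real_inner_self_eq_norm_sq, he1] at h
      linarith
    have hBve : ⟪B v e1, e2n⟫ = ⟪v, v⟫ := by
      have h := hB v e1 e2n
      simp [inner_add_left, inner_sub_left, inner_smul_left,
        hJf, hJe1, hee, hff, hef, hlb1, hN1e v hv, hN1f v hv, hxe v hv, hxf v hv,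
        hxe _ (hJN1 v hv), hxf _ (hJN1 v hv), hN1f _ (hAN1 _ (hJN1 v hv)), hN1e _ (hAN1 v hv),
        he1N1 v hv,
        he12, he21, he1, he2n] at h
      rw [real_inner_self_eq_norm_sq]
      linarith
    have h1 := hR e2n e1 e1 e2n
    rw [hself] at h1
    simp only [bismutCurv, inner_sub_left, inner_zero_left, hlb1, map_add, map_smul,
      LinearMap.add_apply, LinearMap.smul_apply, inner_add_left, inner_smul_left, hBee, hBve,
      hBfe, map_zero] at h1
    rw [hskew, hBff, inner_zero_right] at h1
    simp only [conj_trivial] at h1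
    have hvv : 0 ≤ ⟪v, v⟫ := real_inner_self_nonneg
    have ha : a = 0 := by nlinarith
    have hv0 : v = 0 := by
      apply (inner_self_eq_zero (𝕜 := ℝ)).mp
      nlinarith
    refine ⟨ha, hv0, ?_⟩
    subst ha
    subst hv0
    have hBee0 : B e1 e1 = 0 := by
      apply hzero
      intro z
      obtain ⟨s, t, w, hw, rfl⟩ := hspan z
      have h := hB e1 e1 (s • e1 + w + t • e2n)
      simp [inner_add_left, inner_add_right, inner_sub_left, inner_smul_left, inner_smul_right,
        hJf, hJe1, hee, hff, hef, hlb1, hlb2 _ hw, hex _ hw, hlb2 _ (hJN1 w hw), hex _ (hJN1 w hw),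
        hN1e _ (hAN1 w hw), hN1e _ (hAN1 _ (hJN1 w hw)),
        he12, he21, he1, he2n] at h ⊢
      linarith
    have hsw : ∀ x ∈ N1, B e1 x = - B x e1 := by
      intro x hx
      rw [← sub_eq_zero]
      apply hzero
      intro z
      obtain ⟨s, t, w, hw, rfl⟩ := hspan z
      have h := hB e1 x (s • e1 + w + t • e2n)
      have h' := hB x e1 (s • e1 + w + t • e2n)
      simp [inner_add_left, inner_add_right, inner_sub_left, inner_smul_left, inner_smul_right,
        hJf, hJe1, hee, hff, hef, hlb1, hlb2 _ hw, hex _ hw, hlb2 _ (hJN1 w hw), hex _ (hJN1 w hw),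
        hlb2 _ hx, hex _ hx, hlb2 _ (hJN1 x hx), hex _ (hJN1 x hx),
        hxe _ hx, hxe _ (hJN1 x hx), hxf _ hx, hxf _ (hJN1 x hx), hxx x hx w hw,
        hxx _ (hJN1 x hx) _ (hJN1 w hw),
        hN1e _ (hAN1 w hw), hN1e _ (hAN1 _ (hJN1 w hw)),
        hN1e _ (hAN1 x hx), hN1e _ (hAN1 _ (hJN1 x hx)),
        hN1f _ (hAN1 x hx), hN1f _ (hAN1 _ (hJN1 x hx)),
        he12, he21, he1, he2n] at h h' ⊢
      linarith
    have hBx : ∀ x ∈ N1, B x e1 = 0 := by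
      intro x hx
      have h := hR e1 x x e1
      rw [hself] at h
      simp only [bismutCurv, inner_sub_left, inner_zero_left, hex x hx, map_zero,
        LinearMap.zero_apply] at h
      rw [hskew e1, hskew x (B e1 x), hBee0, hsw x hx, inner_neg_left, inner_zero_right] at h
      apply (inner_self_eq_zero (𝕜 := ℝ)).mp
      linarith
    intro y hy w hw
    have h := hB (J y) e1 w
    rw [hBx _ (hJN1 y hy)] at h
    have h5 : ⟪J (A w), J y⟫ = ⟪A w, y⟫ := hJorth _ _
    simp [inner_add_left, inner_sub_left, hJe1, hJ2, hxe _ (hJN1 y hy), hxf y hy,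
      hxx _ (hJN1 y hy) w hw, hxx y hy _ (hJN1 w hw), hex w hw, hlb2 _ (hJN1 w hw), hAJ w hw,
      h5] at h
    rw [real_inner_comm (A w) y]
    linarith
  · rintro ⟨rfl, rfl, hA⟩
    have hA' : ∀ x ∈ N1, ∀ y ∈ N1, ⟪A x, y⟫ = -⟪A y, x⟫ := fun x hx y hy => by
      rw [hA x hx y hy, real_inner_comm]
    have hBe : B e1 = 0 := by
      ext y
      apply hzero
      intro z
      obtain ⟨s, t, w, hw, rfl⟩ := hspan z
      obtain ⟨p, q, x, hx, rfl⟩ := hspan y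
      have h := hB e1 (p • e1 + x + q • e2n) (s • e1 + w + t • e2n)
      have h2 : ⟪A (J x), w⟫ = ⟪A (J w), x⟫ := by
        rw [hA' _ (hJN1 x hx) w hw, hAJ w hw, ← hJorth (A w), hJ2, inner_neg_right, neg_neg]
      simp [inner_add_left, inner_add_right, inner_sub_left, inner_smul_left, inner_smul_right,
        hJf, hJe1, hee, hff, hef, hlb1, hlb2 _ hw, hex _ hw, hlb2 _ (hJN1 w hw), hex _ (hJN1 w hw),
        hlb2 _ hx, hex _ hx, hlb2 _ (hJN1 x hx), hex _ (hJN1 x hx),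
        hxe _ hx, hxe _ (hJN1 x hx), hxf _ hx, hxf _ (hJN1 x hx), hxx x hx w hw,
        hxx _ (hJN1 x hx) _ (hJN1 w hw),
        hN1e _ (hAN1 w hw), hN1e _ (hAN1 _ (hJN1 w hw)),
        hN1e _ (hAN1 x hx), hN1e _ (hAN1 _ (hJN1 x hx)),
        hN1f _ (hAN1 x hx), hN1f _ (hAN1 _ (hJN1 x hx)), hN1f _ (hAN1 w hw),
        hN1f _ (hAN1 _ (hJN1 w hw)), h2,
        he12, he21, he1, he2n] at h ⊢
      linarith
    have hBx : ∀ u ∈ N1, B u = 0 := by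
      intro u hu
      ext y
      apply hzero
      intro z
      obtain ⟨s, t, w, hw, rfl⟩ := hspan z
      obtain ⟨p, q, x, hx, rfl⟩ := hspan y
      have h := hB u (p • e1 + x + q • e2n) (s • e1 + w + t • e2n)
      have hJA : ∀ x ∈ N1, ∀ w ∈ N1, ⟪A (J x), w⟫ = ⟪A (J w), x⟫ := by
        intro x hx w hw
        rw [hA' _ (hJN1 x hx) w hw, hAJ w hw, ← hJorth (A w), hJ2, inner_neg_right, neg_neg]
      simp [inner_add_left, inner_add_right, inner_sub_left, inner_smul_left, inner_smul_right,
        hJf, hJe1, hee, hff, hef, hlb1, hlb2 _ hw, hex _ hw, hlb2 _ (hJN1 w hw), hex _ (hJN1 w hw),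
        hlb2 _ hx, hex _ hx, hlb2 _ (hJN1 x hx), hex _ (hJN1 x hx),
        hxe _ hx, hxe _ (hJN1 x hx), hxf _ hx, hxf _ (hJN1 x hx), hxx x hx w hw,
        hxx _ (hJN1 x hx) _ (hJN1 w hw), hxx u hu w hw, hxx u hu x hx,
        hxx _ (hJN1 u hu) _ (hJN1 w hw), hxx _ (hJN1 u hu) _ (hJN1 x hx),
        hxe _ hu, hxe _ (hJN1 u hu), hxf _ hu, hxf _ (hJN1 u hu),
        hN1e _ (hAN1 u hu), hN1e _ (hAN1 _ (hJN1 u hu)),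
        hN1f _ (hAN1 u hu), hN1f _ (hAN1 _ (hJN1 u hu)),
        he12, he21, he1, he2n, hA' u hu w hw, hA' u hu x hx, hJA u hu w hw, hJA u hu x hx] at h ⊢
      linarith
    have hlbN : ∀ x y : G, B (lb x y) = 0 := by
      intro x y
      obtain ⟨s, t, w, hw, rfl⟩ := hspan x
      obtain ⟨p, q, u, hu, rfl⟩ := hspan y
      simp [hee, hff, hef, hlb1, hlb2 _ hu, hex _ hu, hxe _ hw, hxf _ hw, hxx w hw u hu,
        hBx _ (hAN1 u hu), hBx _ (hAN1 w hw)]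
    have hcurv : ∀ x y z : G, bismutCurv lb B x y z = 0 := by
      intro x y z
      unfold bismutCurv
      rw [hlbN]
      obtain ⟨s, t, w, hw, rfl⟩ := hspan x
      obtain ⟨p, q, u, hu, rfl⟩ := hspan y
      simp [hBe, hBx _ hw, hBx _ hu, smul_smul, mul_comm]
    intro x y z w
    rw [hcurv, hcurv]
end

section
/- With the almost abelian Hermitian setup below, the Bismut connection is flat, i.e., Rᴮ(x, y)z = 0 for all x, y, z ∈ 𝔤, if and only if a = 0, v = 0 and A ∈ 𝔰𝔬(𝔫₁). -/
open RealInnerProductSpace Module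

theorem bismut_flat_iff_almost_abelian
    {G : Type*} [NormedAddCommGroup G] [InnerProductSpace ℝ G] [FiniteDimensional ℝ G]
    (n : ℕ) (hn : 2 ≤ n) (hdim : finrank ℝ G = 2 * n)
    (e1 e2n : G) (N1 : Submodule ℝ G) (hdimN1 : finrank ℝ N1 = 2 * n - 2)
    (he1 : ⟪e1, e1⟫ = 1) (he2n : ⟪e2n, e2n⟫ = 1) (he12 : ⟪e1, e2n⟫ = 0)
    (he1N1 : ∀ x ∈ N1, ⟪e1, x⟫ = 0) (he2nN1 : ∀ x ∈ N1, ⟪e2n, x⟫ = 0)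
    (hspan : ∀ z : G, ∃ (s t : ℝ) (x : G), x ∈ N1 ∧ z = s • e1 + x + t • e2n)
    (J : G →ₗ[ℝ] G)
    (hJorth : ∀ x y : G, ⟪J x, J y⟫ = ⟪x, y⟫)
    (hJ2 : ∀ x : G, J (J x) = -x)
    (hJe1 : J e1 = e2n)
    (hJN1 : ∀ x ∈ N1, J x ∈ N1)
    (a : ℝ) (v : G) (hv : v ∈ N1)
    (A : G →ₗ[ℝ] G) (hAN1 : ∀ x ∈ N1, A x ∈ N1)
    (hAJ : ∀ x ∈ N1, A (J x) = J (A x))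
    (lb : G →ₗ[ℝ] G →ₗ[ℝ] G)
    (hanti : ∀ x y : G, lb x y = - lb y x)
    (hlb1 : lb e2n e1 = a • e1 + v)
    (hlb2 : ∀ x ∈ N1, lb e2n x = A x)
    (hlb0 : ∀ (s t : ℝ), ∀ x ∈ N1, ∀ y ∈ N1, lb (s • e1 + x) (t • e1 + y) = 0)
    (B : G →ₗ[ℝ] G →ₗ[ℝ] G)
    (hB : ∀ x y z : G, 2 * ⟪B x y, z⟫ =
      ⟪lb x y - lb (J x) (J y), z⟫ - ⟪lb x z - lb (J x) (J z), y⟫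
        - ⟪lb y z + lb (J y) (J z), x⟫)
    :
    (∀ x y z : G, bismutCurv lb B x y z = 0) ↔
      (a = 0 ∧ v = 0 ∧ ∀ x ∈ N1, ∀ y ∈ N1, ⟪A x, y⟫ = -⟪x, A y⟫) := by
  have e2 : J e2n = -e1 := by rw [← hJe1, hJ2]
  have hff : lb e2n e2n = 0 := by
    have h := hanti e2n e2n
    have h2 : (2 : ℝ) • lb e2n e2n = 0 := by
      rw [two_smul]; nth_rewrite 1 [h]; simp
    simpa using h2
  have hJd : ∀ (s t : ℝ) (x : G), J (s • e1 + x + t • e2n) = (-t) • e1 + J x + s • e2n := by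
    intro s t x
    simp only [map_add, map_smul, hJe1, e2]
    module
  have hL : ∀ (s t s' t' : ℝ) (x x' : G), x ∈ N1 → x' ∈ N1 →
      lb (s • e1 + x + t • e2n) (s' • e1 + x' + t' • e2n) =
        (t * s' - s * t') • (a • e1 + v) + t • A x' - t' • A x := by
    intro s t s' t' x x' hx hx'
    have h1 : lb (s • e1 + x) e2n = - (s • (a • e1 + v) + A x) := by
      rw [hanti]; simp only [map_add, map_smul, hlb1, hlb2 x hx]
    have h2 : lb e2n (s' • e1 + x') = (s' • (a • e1 + v) + A x') := by
      simp only [map_add, map_smul, hlb1, hlb2 x' hx']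
    rw [map_add lb, LinearMap.add_apply, map_add (lb (s • e1 + x)), hlb0 s s' x hx x' hx',
      map_smul lb, LinearMap.smul_apply, map_add (lb e2n), h2, map_smul, map_smul, h1, hff]
    module
  have he21 : ⟪e2n, e1⟫ = 0 := by rw [real_inner_comm]; exact he12
  have hN1e : ∀ x ∈ N1, ⟪x, e1⟫ = 0 := fun x hx => by rw [real_inner_comm]; exact he1N1 x hx
  have hN1f : ∀ x ∈ N1, ⟪x, e2n⟫ = 0 := fun x hx => by rw [real_inner_comm]; exact he2nN1 x hx
  have hI : ∀ (s t s' t' : ℝ) (x x' : G), x ∈ N1 → x' ∈ N1 →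
      ⟪s • e1 + x + t • e2n, s' • e1 + x' + t' • e2n⟫ = s * s' + ⟪x, x'⟫ + t * t' := by
    intro s t s' t' x x' hx hx'
    simp only [inner_add_left, inner_add_right, real_inner_smul_left, real_inner_smul_right,
      he1, he2n, he12, he21, hN1e x hx, hN1f x hx, he1N1 x' hx', he2nN1 x' hx']
    ring
  have hLI : ∀ (s t s' t' s'' t'' : ℝ) (x x' x'' : G), x ∈ N1 → x' ∈ N1 → x'' ∈ N1 →
      ⟪lb (s • e1 + x + t • e2n) (s' • e1 + x' + t' • e2n), s'' • e1 + x'' + t'' • e2n⟫ =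
        (t * s' - s * t') * (a * s'' + ⟪v, x''⟫) + t * ⟪A x', x''⟫ - t' * ⟪A x, x''⟫ := by
    intro s t s' t' s'' t'' x x' x'' hx hx' hx''
    rw [hL _ _ _ _ _ _ hx hx']
    have : (t * s' - s * t') • (a • e1 + v) + t • A x' - t' • A x =
      ((t * s' - s * t') * a) • e1 + ((t * s' - s * t') • v + t • A x' - t' • A x)
        + (0 : ℝ) • e2n := by module
    rw [this, hI _ _ _ _ _ _ (N1.sub_mem (N1.add_mem (N1.smul_mem _ hv)
      (N1.smul_mem _ (hAN1 _ hx'))) (N1.smul_mem _ (hAN1 _ hx))) hx'']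
    simp only [inner_add_left, inner_sub_left, real_inner_smul_left]
    ring
  have hBd : ∀ (s t s' t' s'' t'' : ℝ) (x x' x'' : G), x ∈ N1 → x' ∈ N1 → x'' ∈ N1 →
      2 * ⟪B (s • e1 + x + t • e2n) (s' • e1 + x' + t' • e2n), s'' • e1 + x'' + t'' • e2n⟫ =
        (t * ⟪A x', x''⟫ - t' * ⟪A x, x''⟫ - s * ⟪A (J x'), x''⟫ + s' * ⟪A (J x), x''⟫)
        - (t * ⟪A x'', x'⟫ - t'' * ⟪A x, x'⟫ - s * ⟪A (J x''), x'⟫ + s'' * ⟪A (J x), x'⟫)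
        - (2 * (t' * s'' - s' * t'') * (a * s + ⟪v, x⟫)
          + t' * ⟪A x'', x⟫ - t'' * ⟪A x', x⟫ + s' * ⟪A (J x''), x⟫ - s'' * ⟪A (J x'), x⟫) := by
    intro s t s' t' s'' t'' x x' x'' hx hx' hx''
    have j := hJN1 x hx
    have j' := hJN1 x' hx'
    have j'' := hJN1 x'' hx''
    rw [hB, hJd, hJd, hJd, inner_sub_left, inner_sub_left, inner_add_left]
    rw [hLI _ _ _ _ _ _ _ _ _ hx hx' hx'', hLI _ _ _ _ _ _ _ _ _ j j' hx'',
      hLI _ _ _ _ _ _ _ _ _ hx hx'' hx', hLI _ _ _ _ _ _ _ _ _ j j'' hx',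
      hLI _ _ _ _ _ _ _ _ _ hx' hx'' hx, hLI _ _ _ _ _ _ _ _ _ j' j'' hx]
    ring
  have h0 : (0 : G) ∈ N1 := N1.zero_mem
  have de : e1 = (1 : ℝ) • e1 + 0 + (0 : ℝ) • e2n := by simp
  have df : e2n = (0 : ℝ) • e1 + 0 + (1 : ℝ) • e2n := by simp
  have dx : ∀ x : G, x = (0 : ℝ) • e1 + x + (0 : ℝ) • e2n := by intro x; simp
  have hext : ∀ u w : G, (∀ (s t : ℝ) (x : G), x ∈ N1 → 2 * ⟪u, s • e1 + x + t • e2n⟫ =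
      2 * ⟪w, s • e1 + x + t • e2n⟫) → u = w := by
    intro u w h
    refine ext_inner_right ℝ fun z => ?_
    obtain ⟨s, t, x, hx, rfl⟩ := hspan z
    have := h s t x hx
    linarith
  have hskew : ∀ x y z : G, ⟪B x y, z⟫ = -⟪y, B x z⟫ := by
    intro x y z
    have h1 := hB x y z
    have h2 := hB x z y
    rw [real_inner_comm (B x z) y] at *
    have h3 : ⟪lb z y + lb (J z) (J y), x⟫ = -⟪lb y z + lb (J y) (J z), x⟫ := by
      rw [hanti z y, hanti (J z) (J y), ← inner_neg_left]; congr 1; abel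
    rw [h3] at h2
    linarith
  have hJs : ∀ x y : G, ⟪J x, y⟫ = -⟪x, J y⟫ := by
    intro x y
    rw [← hJorth x (J y), hJ2, inner_neg_right, neg_neg]
  constructor
  · intro hflat
    -- B_e e = a f
    have bee : B e1 e1 = a • e2n := by
      apply hext
      intro s t z hz
      have h := hBd 1 0 1 0 s t 0 0 z h0 h0 hz
      rw [← de] at h
      rw [h]
      simp only [inner_add_right, real_inner_smul_right, real_inner_smul_left, he2n, he21,
        he2nN1 z hz, map_zero, inner_zero_left, inner_zero_right]
      ring
    have bfe : B e2n e1 = 0 := by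
      apply hext
      intro s t z hz
      have h := hBd 0 1 1 0 s t 0 0 z h0 h0 hz
      rw [← de, ← df] at h
      rw [h]
      simp
    have bff : B e2n e2n = 0 := by
      apply hext
      intro s t z hz
      have h := hBd 0 1 0 1 s t 0 0 z h0 h0 hz
      rw [← df] at h
      rw [h]
      simp
    have key : a = 0 ∧ v = 0 := by
      have h := hflat e1 e2n e1
      unfold bismutCurv at h
      rw [bfe, bee, hanti e1 e2n, hlb1] at h
      simp only [map_zero, map_smul, bff, smul_zero, sub_zero, map_neg, LinearMap.neg_apply,
        map_add, LinearMap.add_apply, LinearMap.smul_apply, bee] at h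
      have h2 := congrArg (fun u => ⟪u, e2n⟫) h
      have h3 := hBd 0 0 1 0 0 1 v 0 0 hv h0 h0
      rw [← de, ← df, ← dx v] at h3
      simp at h3
      simp only [inner_sub_left, inner_neg_left, inner_add_left, real_inner_smul_left, he2n,
        inner_zero_left, h3] at h2
      have h4 : 0 ≤ ⟪v, v⟫ := real_inner_self_nonneg
      have h5 : ⟪v, v⟫ = a * 0 + ⟪v, v⟫ := by ring
      have h6 : a * a + ⟪v, v⟫ = 0 := by
        simp only [real_inner_self_eq_norm_sq] at *
        linarith
      constructor
      · nlinarith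
      · have : ⟪v, v⟫ = 0 := by nlinarith
        exact inner_self_eq_zero.mp this
    obtain ⟨ha, hv0⟩ := key
    refine ⟨ha, hv0, ?_⟩
    have c1 : ∀ x ∈ N1, B (J x) e1 = B x e2n := by
      intro x hx
      apply hext
      intro s t z hz
      have h := hBd 0 0 1 0 s t (J x) 0 z (hJN1 x hx) h0 hz
      have h' := hBd 0 0 0 1 s t x 0 z hx h0 hz
      rw [← de, ← dx] at h
      rw [← df, ← dx] at h'
      rw [h, h', hJ2, hAJ z hz, hJorth]
      simp [hv0]
    have c2 : ∀ x ∈ N1, B (J x) e2n = - B x e1 := by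
      intro x hx
      have h := c1 (J x) (hJN1 x hx)
      rw [hJ2] at h
      rw [← h]; simp
    have c3 : ∀ x ∈ N1, B x e2n = 0 := by
      intro x hx
      have h := hflat x (J x) e1
      unfold bismutCurv at h
      have hl : lb x (J x) = 0 := by
        have := hlb0 0 0 x hx (J x) (hJN1 x hx)
        simpa using this
      rw [hl, c1 x hx] at h
      have h2 := congrArg (fun u => ⟪u, e2n⟫) h
      simp only [map_zero, LinearMap.zero_apply, sub_zero, inner_sub_left, inner_zero_left] at h2
      rw [hskew x, hskew (J x), c2 x hx, inner_neg_right] at h2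
      have h4 : 0 ≤ ⟪B x e1, B x e1⟫ := real_inner_self_nonneg
      have h5 : 0 ≤ ⟪B x e2n, B x e2n⟫ := real_inner_self_nonneg
      have : ⟪B x e2n, B x e2n⟫ = 0 := by linarith
      exact inner_self_eq_zero.mp this
    intro x hx y hy
    have h' := hBd 0 0 0 1 0 0 x 0 y hx h0 hy
    rw [← df, ← dx, c3 x hx] at h'
    simp at h'
    rw [real_inner_comm]
    rw [real_inner_comm] at h'
    rw [real_inner_comm (A y) x]
    linarith
  · rintro ⟨ha, hv0, hA⟩
    have hA' : ∀ x ∈ N1, ∀ y ∈ N1, ⟪A x, y⟫ = -⟪A y, x⟫ := by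
      intro x hx y hy
      rw [hA x hx y hy, real_inner_comm]
    have hAJ' : ∀ x ∈ N1, ∀ y ∈ N1, ⟪A (J x), y⟫ = ⟪A (J y), x⟫ := by
      intro x hx y hy
      rw [hA' (J x) (hJN1 x hx) y hy, hAJ y hy, hJs, real_inner_comm]
    have hBN : ∀ (s : ℝ) (x y : G), x ∈ N1 → B (s • e1 + x) y = 0 := by
      intro s x y hx
      obtain ⟨s', t', x', hx', rfl⟩ := hspan y
      apply hext
      intro s'' t'' z hz
      have h := hBd s 0 s' t' s'' t'' x x' z hx hx' hz
      rw [zero_smul, add_zero] at h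
      rw [h, hA' z hz x hx, hA' x' hx' x hx, hAJ' z hz x hx, hAJ' x' hx' x hx, hAJ' x' hx' z hz,
        ha, hv0]
      simp only [inner_zero_left]
      ring
    intro x y z
    obtain ⟨s, t, x, hx, rfl⟩ := hspan x
    obtain ⟨s', t', x', hx', rfl⟩ := hspan y
    unfold bismutCurv
    have hl : lb (s • e1 + x + t • e2n) (s' • e1 + x' + t' • e2n) =
        (0 : ℝ) • e1 + (t • A x' - t' • A x) := by
      rw [hL _ _ _ _ _ _ hx hx', ha, hv0]
      module
    rw [hl, hBN 0 _ z (N1.sub_mem (N1.smul_mem _ (hAN1 _ hx')) (N1.smul_mem _ (hAN1 _ hx)))]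
    have hP : ∀ (s t : ℝ) (x y : G), x ∈ N1 → B (s • e1 + x + t • e2n) y = t • B e2n y := by
      intro s t x y hx
      rw [map_add B, LinearMap.add_apply, hBN s x y hx, map_smul, LinearMap.smul_apply, zero_add]
    simp only [hP s t x _ hx, hP s' t' x' _ hx', map_smul, sub_zero]
    rw [smul_comm, sub_self]
end

section
/- With the almost abelian Hermitian setup below, if v = 0 and A ∈ 𝔰𝔬(𝔫₁), then the Bismut connection is torsion-free: Tᴮ(x, y) = 0 for all x, y ∈ 𝔤 (i.e., the Hermitian structure (J, g) is Kähler). -/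
open RealInnerProductSpace Module

theorem bismut_torsion_free_almost_abelian
    {G : Type*} [NormedAddCommGroup G] [InnerProductSpace ℝ G] [FiniteDimensional ℝ G]
    (n : ℕ) (hn : 2 ≤ n) (hdim : finrank ℝ G = 2 * n)
    (e1 e2n : G) (N1 : Submodule ℝ G) (hdimN1 : finrank ℝ N1 = 2 * n - 2)
    (he1 : ⟪e1, e1⟫ = 1) (he2n : ⟪e2n, e2n⟫ = 1) (he12 : ⟪e1, e2n⟫ = 0)
    (he1N1 : ∀ x ∈ N1, ⟪e1, x⟫ = 0) (he2nN1 : ∀ x ∈ N1, ⟪e2n, x⟫ = 0)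
    (hspan : ∀ z : G, ∃ (s t : ℝ) (x : G), x ∈ N1 ∧ z = s • e1 + x + t • e2n)
    (J : G →ₗ[ℝ] G)
    (hJorth : ∀ x y : G, ⟪J x, J y⟫ = ⟪x, y⟫)
    (hJ2 : ∀ x : G, J (J x) = -x)
    (hJe1 : J e1 = e2n)
    (hJN1 : ∀ x ∈ N1, J x ∈ N1)
    (a : ℝ) (v : G) (hv : v ∈ N1)
    (A : G →ₗ[ℝ] G) (hAN1 : ∀ x ∈ N1, A x ∈ N1)
    (hAJ : ∀ x ∈ N1, A (J x) = J (A x))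
    (lb : G →ₗ[ℝ] G →ₗ[ℝ] G)
    (hanti : ∀ x y : G, lb x y = - lb y x)
    (hlb1 : lb e2n e1 = a • e1 + v)
    (hlb2 : ∀ x ∈ N1, lb e2n x = A x)
    (hlb0 : ∀ (s t : ℝ), ∀ x ∈ N1, ∀ y ∈ N1, lb (s • e1 + x) (t • e1 + y) = 0)
    (B : G →ₗ[ℝ] G →ₗ[ℝ] G)
    (hB : ∀ x y z : G, 2 * ⟪B x y, z⟫ =
      ⟪lb x y - lb (J x) (J y), z⟫ - ⟪lb x z - lb (J x) (J z), y⟫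
        - ⟪lb y z + lb (J y) (J z), x⟫)
    (hv0 : v = 0)
    (hskew : ∀ x ∈ N1, ∀ y ∈ N1, ⟪A x, y⟫ = -⟪x, A y⟫)
    :
    ∀ x y : G, bismutTorsion lb B x y = 0 := by
  subst hv0
  have hJe2 : J e2n = -e1 := by rw [← hJe1, hJ2]
  have hself : ∀ x, lb x x = 0 := fun x => by
    have h := hanti x x
    have h2 : (2 : ℝ) • lb x x = 0 := by
      rw [two_smul]
      nth_rewrite 1 [h]
      simp
    exact (smul_eq_zero.mp h2).resolve_left (by norm_num)
  have hlb : ∀ (s1 t1 s2 t2 : ℝ), ∀ x ∈ N1, ∀ y ∈ N1,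
      lb (s1 • e1 + x + t1 • e2n) (s2 • e1 + y + t2 • e2n)
        = t1 • (s2 • a • e1 + A y) - t2 • (s1 • a • e1 + A x) := by
    intro s1 t1 s2 t2 x hx y hy
    have h0 := hlb0 s1 s2 x hx y hy
    rw [map_add lb, LinearMap.add_apply, map_add (lb (s1 • e1 + x)), h0,
      map_smul (lb (s1 • e1 + x)), hanti (s1 • e1 + x) e2n]
    simp only [map_add, map_smul, LinearMap.add_apply, LinearMap.smul_apply, hlb1, hlb2 x hx,
      hlb2 y hy, hself, add_zero, smul_zero, smul_neg, zero_add]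
    module
  have hJ : ∀ (s t : ℝ) (x : G), J (s • e1 + x + t • e2n) = (-t) • e1 + J x + s • e2n := by
    intro s t x
    simp only [map_add, map_smul, hJe1, hJe2]
    module
  have hsym : ∀ x ∈ N1, ∀ y ∈ N1, ⟪A (J x), y⟫ = ⟪A (J y), x⟫ := by
    intro x hx y hy
    rw [hskew _ (hJN1 x hx) y hy, ← hJorth (J x) (A y), hJ2, ← hAJ y hy, inner_neg_left, neg_neg,
      real_inner_comm]
  have hform : ∀ (s1 t1 s2 t2 s3 t3 : ℝ), ∀ x ∈ N1, ∀ y ∈ N1, ∀ z ∈ N1,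
      ⟪lb (J (s1 • e1 + x + t1 • e2n)) (J (s2 • e1 + y + t2 • e2n)), s3 • e1 + z + t3 • e2n⟫
        = a * s3 * (s2 * t1 - s1 * t2) + s1 * ⟪A (J y), z⟫ - s2 * ⟪A (J x), z⟫ := by
    intro s1 t1 s2 t2 s3 t3 x hx y hy z hz
    have hx' := hAN1 _ (hJN1 x hx)
    have hy' := hAN1 _ (hJN1 y hy)
    rw [hJ, hJ, hlb _ _ _ _ _ (hJN1 x hx) _ (hJN1 y hy)]
    have c1 : ⟪A (J x), e1⟫ = 0 := by rw [real_inner_comm]; exact he1N1 _ hx'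
    have c2 : ⟪A (J x), e2n⟫ = 0 := by rw [real_inner_comm]; exact he2nN1 _ hx'
    have c3 : ⟪A (J y), e1⟫ = 0 := by rw [real_inner_comm]; exact he1N1 _ hy'
    have c4 : ⟪A (J y), e2n⟫ = 0 := by rw [real_inner_comm]; exact he2nN1 _ hy'
    simp only [inner_add_left, inner_add_right, inner_sub_left, real_inner_smul_left,
      real_inner_smul_right, c1, c2, c3, c4, he1, he12, he1N1 z hz]
    ring
  intro x y
  refine ext_inner_right ℝ fun z => ?_
  have h1 := hB x y z
  have h2 := hB y x z
  have e : ⟪lb (J x) (J y), z⟫ - ⟪lb (J x) (J z), y⟫ + ⟪lb (J y) (J z), x⟫ = 0 := by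
    obtain ⟨s1, t1, x, hx, rfl⟩ := hspan x
    obtain ⟨s2, t2, y, hy, rfl⟩ := hspan y
    obtain ⟨s3, t3, z, hz, rfl⟩ := hspan z
    rw [hform _ _ _ _ _ _ x hx y hy z hz, hform _ _ _ _ _ _ x hx z hz y hy,
      hform _ _ _ _ _ _ y hy z hz x hx, hsym y hy z hz, hsym x hx z hz, hsym x hx y hy]
    ring
  rw [hanti y x, hanti (J y) (J x)] at h2
  simp only [bismutTorsion, inner_sub_left, inner_add_left, inner_neg_left, inner_zero_left] at *
  linarith
end

section
/- Let M be the real 6×6 matrix with entries M₁₁ = M₂₂ = M₃₃ = M₆₆ = 1, M₄₄ = M₅₅ = −1, M₂₁ = π, and all other entries 0. Let N be the 6×6 matrix with integer entries whose rows are (2,−1,1,0,0,0), (1,0,1,0,0,0), (0,0,1,0,0,0), (0,0,0,−1,0,0), (0,0,0,0,−1,0), (0,0,0,0,0,1). Then M is conjugate to N in GL(6,ℝ): there exists an invertible real 6×6 matrix P with P M P⁻¹ = N. In particular, M is conjugate to an integral matrix. -/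
/-- The matrix `φ(π) = exp(π · ad e₆)` for the 6-dimensional almost abelian Lie algebra
with brackets `[e₆,e₁] = e₂`, `[e₆,e₄] = e₅`, `[e₆,e₅] = -e₄`. -/
noncomputable def phiPi : Matrix (Fin 6) (Fin 6) ℝ :=
  !![1, 0, 0, 0, 0, 0;
     Real.pi, 1, 0, 0, 0, 0;
     0, 0, 1, 0, 0, 0;
     0, 0, 0, -1, 0, 0;
     0, 0, 0, 0, -1, 0;
     0, 0, 0, 0, 0, 1]

/-- An integral matrix conjugate to `phiPi`. -/
def intModel : Matrix (Fin 6) (Fin 6) ℝ :=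
  !![2, -1, 1, 0, 0, 0;
     1, 0, 1, 0, 0, 0;
     0, 0, 1, 0, 0, 0;
     0, 0, 0, -1, 0, 0;
     0, 0, 0, 0, -1, 0;
     0, 0, 0, 0, 0, 1]

theorem phiPi_conjugate_to_integral_matrix :
    (∃ P : Matrix (Fin 6) (Fin 6) ℝ, IsUnit P ∧ P * phiPi * P⁻¹ = intModel) ∧
      ∃ (Q : Matrix (Fin 6) (Fin 6) ℝ) (Z : Matrix (Fin 6) (Fin 6) ℤ),
        IsUnit Q ∧ Q * phiPi * Q⁻¹ = Z.map (Int.cast : ℤ → ℝ) := by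
  have hpi : Real.pi ≠ 0 := Real.pi_ne_zero
  have key : ∃ P : Matrix (Fin 6) (Fin 6) ℝ, IsUnit P ∧ P * phiPi * P⁻¹ = intModel := by
    let P : Matrix (Fin 6) (Fin 6) ℝ :=
      !![Real.pi, 1, 0, 0, 0, 0;
         0, 1, 1, 0, 0, 0;
         0, 0, 1, 0, 0, 0;
         0, 0, 0, 1, 0, 0;
         0, 0, 0, 0, 1, 0;
         0, 0, 0, 0, 0, 1]
    let R : Matrix (Fin 6) (Fin 6) ℝ :=
      !![Real.pi⁻¹, -Real.pi⁻¹, Real.pi⁻¹, 0, 0, 0;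
         0, 1, -1, 0, 0, 0;
         0, 0, 1, 0, 0, 0;
         0, 0, 0, 1, 0, 0;
         0, 0, 0, 0, 1, 0;
         0, 0, 0, 0, 0, 1]
    have hPR : P * R = 1 := by
      ext i j
      fin_cases i <;> fin_cases j <;>
        simp [P, R, Matrix.mul_apply, Fin.sum_univ_succ, hpi]
    have hconj : P * phiPi = intModel * P := by
      ext i j
      fin_cases i <;> fin_cases j <;>
        simp [P, phiPi, intModel, Matrix.mul_apply, Fin.sum_univ_succ] <;> ring
    refine ⟨P, IsUnit.of_mul_eq_one R hPR, ?_⟩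
    rw [Matrix.inv_eq_right_inv hPR, hconj, Matrix.mul_assoc, hPR, Matrix.mul_one]
  refine ⟨key, ?_⟩
  obtain ⟨P, hP, h⟩ := key
  refine ⟨P, !![2, -1, 1, 0, 0, 0;
     1, 0, 1, 0, 0, 0;
     0, 0, 1, 0, 0, 0;
     0, 0, 0, -1, 0, 0;
     0, 0, 0, 0, -1, 0;
     0, 0, 0, 0, 0, 1], hP, ?_⟩
  rw [h]
  ext i j
  fin_cases i <;> fin_cases j <;> simp [intModel]
end
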